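/- arXiv:2511.04529 — 3 statements merged into one kernel-verified Lean document; each statement's English description precedes it below -/
import Mathlib

section
/- Let a, b, d be integers with d ≠ 0 such that the cubic x³ + d²a·x + d³b has nonzero discriminant, i.e. −4(d²a)³ − 27(d³b)² ≠ 0. Then the set of integer solutions {(x, y) ∈ ℤ × ℤ : y² = x³ + d²a·x + d³b} is finite. -/
section

open Polynomial Finset

theorem Polynomial.coeff_taylor_eq_sum {R : Type*} [CommRing R] (f : R[X]) {N : ℕ}
    (hN : f.natDegree < N) (r : R) (l : ℕ) :
    (taylor r f).coeff l = ∑ j ∈ range N, (j.choose l : R) * f.coeff j * r ^ (j - l) := by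
  rw [taylor_coeff, hasseDeriv_apply, sum_over_range' _ (by simp) N hN, eval_finsetSum]
  simp [eval_monomial]

theorem Polynomial.abs_coeff_taylor_le {f : ℝ[X]} {N : ℕ} (hN : f.natDegree < N) {r B D : ℝ}
    {l : ℕ} (hB : ∀ j, |f.coeff j| ≤ B) (hD : ∀ j < N, f.coeff j ≠ 0 → |r| ^ (j - l) ≤ D)
    (hD0 : 0 ≤ D) :
    |(taylor r f).coeff l| ≤ N * (2 ^ N * B * D) := by
  have hB0 : 0 ≤ B := (abs_nonneg _).trans (hB 0)
  rw [coeff_taylor_eq_sum f hN]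
  refine (abs_sum_le_sum_abs _ _).trans ?_
  have : ∀ j ∈ range N, |(j.choose l : ℝ) * f.coeff j * r ^ (j - l)| ≤ 2 ^ N * B * D := by
    intro j hj
    rw [mem_range] at hj
    by_cases h0 : f.coeff j = 0
    · rw [h0]; simp; positivity
    have h1 : (j.choose l : ℝ) ≤ 2 ^ N := by
      have : j.choose l ≤ 2 ^ N :=
        (Nat.choose_le_two_pow j l).trans (Nat.pow_le_pow_right (by norm_num) hj.le)
      exact_mod_cast this
    rw [abs_mul, abs_mul, abs_pow, Nat.abs_cast]
    have := hB j
    have := hD j hj h0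
    gcongr
  refine (sum_le_sum this).trans ?_
  simp

theorem Polynomial.X_sub_C_pow_dvd_iff_coeff_taylor {R : Type*} [CommRing R] (f : R[X]) (r : R)
    (n : ℕ) : (X - C r) ^ n ∣ f ↔ ∀ l < n, (taylor r f).coeff l = 0 := by
  rw [X_sub_C_pow_dvd_iff, X_pow_dvd_iff, taylor_apply]

/-- Powers of an integral element of degree `4` have coordinates of exponential growth. -/
theorem exists_pow_coords {α : ℝ} {b : Fin 4 → ℤ} (hα : α ^ 4 = ∑ i, b i * α ^ (i : ℕ)) :
    ∃ K : ℕ, 1 ≤ K ∧ ∃ c : ℕ → Fin 4 → ℤ, (∀ k, α ^ k = ∑ i, c k i * α ^ (i : ℕ)) ∧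
      ∀ k i, |c k i| ≤ (K : ℤ) ^ k := by
  let c : ℕ → Fin 4 → ℤ := fun k => Nat.rec ![1, 0, 0, 0]
    (fun _ v => ![b 0 * v 3, v 0 + b 1 * v 3, v 1 + b 2 * v 3, v 2 + b 3 * v 3]) k
  have hc : ∀ k, c (k + 1) = ![b 0 * c k 3, c k 0 + b 1 * c k 3, c k 1 + b 2 * c k 3,
    c k 2 + b 3 * c k 3] := fun k => rfl
  refine ⟨1 + ∑ i, (b i).natAbs, by omega, c, ?_, ?_⟩
  · intro k
    induction k with
    | zero => simp [c, Fin.sum_univ_four]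
    | succ k ih =>
      rw [pow_succ, ih, hc]
      simp only [Fin.sum_univ_four] at hα ⊢
      simp at hα ⊢
      linear_combination (Int.cast (c k 3) : ℝ) * hα
  · have hK : ∀ i, 1 + |b i| ≤ ((1 + ∑ i, (b i).natAbs : ℕ) : ℤ) := by
      intro i
      push_cast
      have := Finset.single_le_sum (f := fun i => |b i|) (fun i _ => abs_nonneg _) (mem_univ i)
      simpa using this
    generalize ((1 + ∑ i, (b i).natAbs : ℕ) : ℤ) = K at hK
    have hK1 : 1 ≤ K := (le_add_of_nonneg_right (abs_nonneg _)).trans (hK 0)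
    intro k
    induction k with
    | zero => intro i; fin_cases i <;> simp [c]
    | succ k ih =>
      have hp : 0 ≤ K ^ k := by positivity
      have key : ∀ i j, |c k i + b j * c k 3| ≤ K ^ (k + 1) := by
        intro i j
        calc |c k i + b j * c k 3| ≤ |c k i| + |b j| * |c k 3| := by
              rw [← abs_mul]; exact abs_add_le _ _
          _ ≤ K ^ k + |b j| * K ^ k := by
              have := ih i
              have := ih 3
              gcongr
          _ = (1 + |b j|) * K ^ k := by ring
          _ ≤ K * K ^ k := by have := hK j; gcongr
          _ = K ^ (k + 1) := by ring
      rw [hc]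
      intro i
      fin_cases i
      · have h3 := ih 3
        have : |b 0| ≤ K := by linarith [hK 0]
        simp only [Fin.zero_eta, Matrix.cons_val_zero, abs_mul]
        calc |b 0| * |c k 3| ≤ K * K ^ k := by gcongr
          _ = K ^ (k + 1) := by ring
      · exact key 0 1
      · exact key 1 2
      · exact key 2 3

/-- Thue's auxiliary polynomials: integer polynomials `P`, `Q`, not both zero, of degree less than
`40 s` and of height at most `H ^ s`, such that `P - α Q` vanishes at `α` to order `16 s`. -/
theorem exists_auxiliary_polynomials {α : ℝ} {b : Fin 4 → ℤ}
    (hα : α ^ 4 = ∑ i, b i * α ^ (i : ℕ)) :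
    ∃ H : ℝ, 1 ≤ H ∧ ∀ s : ℕ, 1 ≤ s → ∃ P Q : ℤ[X], (P ≠ 0 ∨ Q ≠ 0) ∧
      P.natDegree < 40 * s ∧ Q.natDegree < 40 * s ∧
      (∀ j, |(P.coeff j : ℝ)| ≤ H ^ s) ∧ (∀ j, |(Q.coeff j : ℝ)| ≤ H ^ s) ∧
      (X - C α) ^ (16 * s) ∣ P.map (Int.castRingHom ℝ) - C α * Q.map (Int.castRingHom ℝ) := by
  obtain ⟨K, hK1, c, hc, hcK⟩ := exists_pow_coords hα
  refine ⟨((2 : ℝ) ^ 120 * K ^ 40) ^ 4, ?_, fun s hs => ?_⟩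
  · have : (1 : ℝ) ≤ K := by exact_mod_cast hK1
    exact one_le_pow₀ (one_le_mul_of_one_le_of_one_le (one_le_pow₀ (by norm_num))
      (one_le_pow₀ this))
  let A : Matrix (Fin (16 * s) × Fin 4) (Fin (40 * s) ⊕ Fin (40 * s)) ℤ :=
    Matrix.of fun x => Sum.elim (fun j => ((j : ℕ).choose x.1 : ℤ) * c (j - x.1) x.2)
      (fun j => -(((j : ℕ).choose x.1 : ℤ) * c (j - x.1 + 1) x.2))
  let _ := Matrix.seminormedAddCommGroup (m := Fin (16 * s) × Fin 4)
    (n := Fin (40 * s) ⊕ Fin (40 * s)) (α := ℤ)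
  obtain ⟨t, ht0, htA, htn⟩ := Int.Matrix.exists_ne_zero_int_vec_norm_le A
    (by simp; omega) (by simp; omega)
  have hK1' : (1 : ℝ) ≤ K := by exact_mod_cast hK1
  have hbin : ∀ j k : ℕ, j < 40 * s → |(j.choose k : ℝ)| ≤ 2 ^ (40 * s) := fun j k hj => by
    have : j.choose k ≤ 2 ^ (40 * s) :=
      (Nat.choose_le_two_pow j k).trans (Nat.pow_le_pow_right (by norm_num) hj.le)
    rw [Nat.abs_cast]
    exact_mod_cast this
  have hcR : ∀ k ≤ 40 * s, ∀ i, |(c k i : ℝ)| ≤ (K : ℝ) ^ (40 * s) := fun k hk i => by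
    have : |(c k i : ℝ)| ≤ (K : ℝ) ^ k := by exact_mod_cast hcK k i
    exact this.trans (pow_le_pow_right₀ hK1' hk)
  have hA : ‖A‖ ≤ 2 ^ (40 * s) * (K : ℝ) ^ (40 * s) := by
    refine (Matrix.norm_le_iff (by positivity)).2 ?_
    rintro ⟨k, i⟩ (j | j)
    · simp only [A, Matrix.of_apply, Sum.elim_inl, Int.norm_eq_abs]
      push_cast
      rw [abs_mul]
      exact mul_le_mul (hbin _ _ j.2) (hcR _ (by omega) _) (abs_nonneg _) (by positivity)
    · simp only [A, Matrix.of_apply, Sum.elim_inr, Int.norm_eq_abs]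
      push_cast
      rw [abs_neg, abs_mul]
      exact mul_le_mul (hbin _ _ j.2) (hcR _ (by omega) _) (abs_nonneg _) (by positivity)
  have ht : ∀ x, |(t x : ℝ)| ≤ (((2 : ℝ) ^ 120 * K ^ 40) ^ 4) ^ s := by
    intro x
    have h1 : |(t x : ℝ)| ≤ ‖t‖ := by rw [← Int.norm_eq_abs]; exact norm_le_pi_norm t x
    refine h1.trans (htn.trans ?_)
    have hs' : (s : ℝ) ≠ 0 := by positivity
    have he : (((Fintype.card (Fin (16 * s) × Fin 4) : ℕ) : ℝ) /
        ((Fintype.card (Fin (40 * s) ⊕ Fin (40 * s)) : ℕ) -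
          (Fintype.card (Fin (16 * s) × Fin 4) : ℕ))) = (4 : ℕ) := by
      simp only [Fintype.card_prod, Fintype.card_sum, Fintype.card_fin]
      push_cast
      have : (40 * (s : ℝ) + 40 * s - 16 * s * 4) = 16 * s := by ring
      rw [this]
      field_simp
    rw [he, Real.rpow_natCast]
    have h80 : ((Fintype.card (Fin (40 * s) ⊕ Fin (40 * s)) : ℕ) : ℝ) ≤ 2 ^ (80 * s) := by
      have : 40 * s + 40 * s ≤ 2 ^ (80 * s) :=
        le_trans (by omega) (Nat.lt_two_pow_self (n := 80 * s)).le
      simp only [Fintype.card_sum, Fintype.card_fin]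
      exact_mod_cast this
    have hmax : max 1 ‖A‖ ≤ 2 ^ (40 * s) * (K : ℝ) ^ (40 * s) :=
      max_le (one_le_mul_of_one_le_of_one_le (one_le_pow₀ (by norm_num)) (one_le_pow₀ hK1')) hA
    calc _ ≤ ((2 : ℝ) ^ (80 * s) * (2 ^ (40 * s) * (K : ℝ) ^ (40 * s))) ^ 4 := by gcongr
      _ = _ := by
        rw [← pow_mul, mul_comm 4 s, pow_mul _ s 4, mul_pow _ _ s, ← pow_mul, ← pow_mul,
          ← mul_assoc, ← pow_add]
        congr 3
        ring
  refine ⟨ofFn (40 * s) (fun j => t (Sum.inl j)), ofFn (40 * s) (fun j => t (Sum.inr j)),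
    ?_, ofFn_natDegree_lt (by omega) _, ofFn_natDegree_lt (by omega) _, ?_, ?_, ?_⟩
  · by_contra! h
    refine ht0 (funext fun x => ?_)
    have hinj := injective_ofFn (R := ℤ) (40 * s)
    have h1 := hinj (h.1.trans (ofFn_zero _).symm)
    have h2 := hinj (h.2.trans (ofFn_zero _).symm)
    rcases x with j | j
    · exact congrFun h1 j
    · exact congrFun h2 j
  · intro j
    rcases lt_or_ge j (40 * s) with h | h
    · rw [ofFn_coeff_eq_val_of_lt _ h]; exact ht _
    · rw [ofFn_coeff_eq_zero_of_ge _ h]; simp; positivity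
  · intro j
    rcases lt_or_ge j (40 * s) with h | h
    · rw [ofFn_coeff_eq_val_of_lt _ h]; exact ht _
    · rw [ofFn_coeff_eq_zero_of_ge _ h]; simp; positivity
  · rw [X_sub_C_pow_dvd_iff_coeff_taylor]
    intro k hk
    have hdeg : ∀ v : Fin (40 * s) → ℤ,
        ((ofFn (40 * s) v).map (Int.castRingHom ℝ)).natDegree < 40 * s := fun v =>
      natDegree_map_le.trans_lt (ofFn_natDegree_lt (by omega) _)
    have hzero : ∀ i : Fin 4, ∑ j : Fin (40 * s), ((j : ℕ).choose k : ℤ) * c (j - k) i * t (.inl j)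
        + ∑ j : Fin (40 * s), -(((j : ℕ).choose k : ℤ) * c (j - k + 1) i) * t (.inr j) = 0 := by
      intro i
      have := congrFun htA (⟨k, hk⟩, i)
      simpa [A, Matrix.mulVec, dotProduct] using this
    rw [map_sub, taylor_mul, taylor_C, coeff_sub, coeff_C_mul, coeff_taylor_eq_sum _ (hdeg _),
      coeff_taylor_eq_sum _ (hdeg _), sum_range, sum_range]
    have e1 : ∀ (v : Fin (40 * s) → ℤ) (j : Fin (40 * s)),
        ((ofFn (40 * s) v).map (Int.castRingHom ℝ)).coeff j = v j := fun v j => by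
      rw [coeff_map, ofFn_coeff_eq_val_of_lt _ j.2]; simp
    simp only [e1]
    have hzR : ∀ i : Fin 4,
        ∑ j : Fin (40 * s), ((j : ℕ).choose k : ℝ) * c (j - k) i * t (.inl j)
        - ∑ j : Fin (40 * s), ((j : ℕ).choose k : ℝ) * c (j - k + 1) i * t (.inr j) = 0 := by
      intro i
      have := congrArg (Int.cast : ℤ → ℝ) (hzero i)
      push_cast at this
      rw [← this, sub_eq_add_neg, ← sum_neg_distrib]
      simp
    have h1 : ∀ j : Fin (40 * s), ((j : ℕ).choose k : ℝ) * t (.inl j) * α ^ ((j : ℕ) - k) =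
        ∑ i, (((j : ℕ).choose k : ℝ) * c (j - k) i * t (.inl j)) * α ^ (i : ℕ) := fun j => by
      rw [hc, mul_sum]
      exact sum_congr rfl fun i _ => by ring
    have h2 : ∀ j : Fin (40 * s), α * (((j : ℕ).choose k : ℝ) * t (.inr j) * α ^ ((j : ℕ) - k)) =
        ∑ i, (((j : ℕ).choose k : ℝ) * c (j - k + 1) i * t (.inr j)) * α ^ (i : ℕ) := fun j => by
      have : α * (((j : ℕ).choose k : ℝ) * t (.inr j) * α ^ ((j : ℕ) - k)) =
        ((j : ℕ).choose k : ℝ) * t (.inr j) * α ^ ((j : ℕ) - k + 1) := by ring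
      rw [this, hc, mul_sum]
      exact sum_congr rfl fun i _ => by ring
    rw [mul_sum, sum_congr rfl fun j _ => h1 j, sum_congr rfl fun j _ => h2 j, sum_comm,
      sum_comm (s := univ) (t := univ) (f := fun (j : Fin (40 * s)) (i : Fin 4) =>
        (((j : ℕ).choose k : ℝ) * c (j - k + 1) i * t (.inr j)) * α ^ (i : ℕ)),
      ← sum_sub_distrib]
    refine sum_eq_zero fun i _ => ?_
    rw [← sum_mul, ← sum_mul, ← sub_mul, hzR, zero_mul]

theorem Polynomial.coeff_X_mul_derivative {R : Type*} [CommRing R] (p : R[X]) (n : ℕ) :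
    (X * derivative p).coeff n = n * p.coeff n := by
  cases n with
  | zero => simp
  | succ n => rw [coeff_X_mul, coeff_derivative]; push_cast; ring

theorem Polynomial.exists_eq_C_mul_of_wronskian_eq_zero {K : Type*} [Field K] [CharZero K]
    {P Q : K[X]} (hQ : Q ≠ 0) (h : wronskian P Q = 0) : ∃ c, P = C c * Q := by
  refine ⟨P.coeff Q.natDegree / Q.leadingCoeff, ?_⟩
  set c := P.coeff Q.natDegree / Q.leadingCoeff with hc
  have hlc : Q.leadingCoeff ≠ 0 := leadingCoeff_ne_zero.2 hQ
  by_contra hne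
  have hR : P - C c * Q ≠ 0 := sub_ne_zero.2 hne
  set R := P - C c * Q with hRdef
  have hRc : R.coeff Q.natDegree = 0 := by
    rw [hRdef, coeff_sub, coeff_C_mul, hc]
    change _ - _ / _ * Q.leadingCoeff = 0
    field_simp
    ring
  have hW : R * (X * derivative Q) = (X * derivative R) * Q := by
    rw [wronskian] at h
    rw [hRdef, derivative_sub, derivative_C_mul]
    linear_combination X * h
  have hle : ∀ p : K[X], (X * derivative p).natDegree ≤ p.natDegree := fun p =>
    natDegree_le_iff_coeff_eq_zero.2 fun n hn => by
      rw [coeff_X_mul_derivative, coeff_eq_zero_of_natDegree_lt hn, mul_zero]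
  have h1 := coeff_mul_add_eq_of_natDegree_le (le_refl R.natDegree) (hle Q)
  rw [hW, coeff_mul_add_eq_of_natDegree_le (hle R) (le_refl Q.natDegree), coeff_X_mul_derivative,
    coeff_X_mul_derivative] at h1
  change _ * R.leadingCoeff * Q.leadingCoeff = R.leadingCoeff * (_ * Q.leadingCoeff) at h1
  have hlr : R.leadingCoeff ≠ 0 := leadingCoeff_ne_zero.2 hR
  have : (R.natDegree : K) = Q.natDegree := by
    apply mul_right_cancel₀ (mul_ne_zero hlr hlc)
    linear_combination h1
  rw [← Nat.cast_injective this] at hRc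
  exact hlr hRc

theorem mul_natDegree_minpoly_le_of_X_sub_C_pow_dvd {α : ℝ} (hα : IsIntegral ℚ α) (m : ℕ) :
    ∀ {Q : ℚ[X]}, Q ≠ 0 → (X - C α) ^ m ∣ Q.map (algebraMap ℚ ℝ) →
      m * (minpoly ℚ α).natDegree ≤ Q.natDegree := by
  induction m with
  | zero => simp
  | succ m ih =>
    intro Q hQ hdvd
    have hroot : aeval α Q = 0 := by
      rw [aeval_def, ← eval_map]
      exact dvd_iff_isRoot.1 ((dvd_pow_self _ m.succ_ne_zero).trans hdvd)
    obtain ⟨Q₁, rfl⟩ := minpoly.dvd ℚ α hroot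
    have hQ₁ : Q₁ ≠ 0 := right_ne_zero_of_mul hQ
    obtain ⟨g, hg⟩ : (X - C α) ∣ (minpoly ℚ α).map (algebraMap ℚ ℝ) :=
      dvd_iff_isRoot.2 (by rw [IsRoot, eval_map, ← aeval_def, minpoly.aeval])
    have hsep : ((minpoly ℚ α).map (algebraMap ℚ ℝ)).Separable :=
      (minpoly.irreducible hα).separable.map
    have hcop : IsCoprime (X - C α) g := by
      rw [hg] at hsep
      exact hsep.isCoprime
    rw [Polynomial.map_mul, hg, pow_succ', mul_assoc] at hdvd
    have hd := (hcop.pow_left (m := m)).dvd_of_dvd_mul_left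
      ((mul_dvd_mul_iff_left (X_sub_C_ne_zero α)).1 hdvd)
    have := ih hQ₁ hd
    rw [natDegree_mul (minpoly.ne_zero hα) hQ₁]
    linarith

/-- The Wronskian of Thue's auxiliary polynomials does not vanish. -/
theorem wronskian_ne_zero_of_X_sub_C_pow_dvd {α : ℝ} (hα : IsIntegral ℚ α)
    (h4 : (minpoly ℚ α).natDegree = 4) {P Q : ℤ[X]} (h0 : P ≠ 0 ∨ Q ≠ 0) {m : ℕ}
    (hP : P.natDegree < m * 4) (hQ : Q.natDegree < m * 4)
    (hdvd : (X - C α) ^ m ∣ P.map (Int.castRingHom ℝ) - C α * Q.map (Int.castRingHom ℝ)) :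
    wronskian P Q ≠ 0 := by
  have hinj : Function.Injective (Int.castRingHom ℝ) := Int.cast_injective
  have key : ∀ {R : ℤ[X]}, R.natDegree < m * 4 → (X - C α) ^ m ∣ R.map (Int.castRingHom ℝ) →
      R = 0 := by
    intro R hR hd
    by_contra hR0
    have h := mul_natDegree_minpoly_le_of_X_sub_C_pow_dvd hα m
      (Q := R.map (Int.castRingHom ℚ)) ((Polynomial.map_ne_zero_iff Int.cast_injective).2 hR0)
      (by
        rw [Polynomial.map_map]
        rwa [RingHom.ext_int ((algebraMap ℚ ℝ).comp (Int.castRingHom ℚ)) (Int.castRingHom ℝ)])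
    rw [h4] at h
    have := natDegree_map_le (f := Int.castRingHom ℚ) (p := R)
    omega
  intro hW
  by_cases hQ0 : Q = 0
  · subst hQ0
    simp only [Polynomial.map_zero, mul_zero, sub_zero] at hdvd
    exact h0.elim (fun h => h (key hP hdvd)) (fun h => h rfl)
  have hWR : wronskian (P.map (Int.castRingHom ℝ)) (Q.map (Int.castRingHom ℝ)) = 0 := by
    rw [wronskian, derivative_map, derivative_map, ← Polynomial.map_mul, ← Polynomial.map_mul,
      ← Polynomial.map_sub]
    rw [wronskian] at hW
    rw [hW, Polynomial.map_zero]
  obtain ⟨c, hc⟩ := exists_eq_C_mul_of_wronskian_eq_zero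
    ((Polynomial.map_ne_zero_iff hinj).2 hQ0) hWR
  have hirr : Irrational α := by
    rintro ⟨q, rfl⟩
    have := minpoly.eq_X_sub_C ℝ q
    simp only [eq_ratCast] at this
    rw [this, natDegree_X_sub_C] at h4
    norm_num at h4
  by_cases hcα : c = α
  · have := congrArg (fun p => p.coeff Q.natDegree) hc
    simp only [coeff_map, coeff_C_mul, hcα, eq_intCast, coeff_natDegree] at this
    have hl : (Q.leadingCoeff : ℝ) ≠ 0 := by exact_mod_cast leadingCoeff_ne_zero.2 hQ0
    refine hirr ⟨P.coeff Q.natDegree / Q.leadingCoeff, ?_⟩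
    push_cast
    rw [this]
    field_simp
  · refine hQ0 (key hQ ?_)
    rw [hc, ← sub_mul, ← C_sub] at hdvd
    exact (IsUnit.dvd_mul_left (isUnit_C.2 (sub_ne_zero.2 hcα).isUnit)).1 hdvd

theorem abs_coeff_wronskian_le {P Q : ℤ[X]} {N : ℕ} (hP : P.natDegree < N) (hQ : Q.natDegree < N)
    {B : ℝ} (hPB : ∀ j, |(P.coeff j : ℝ)| ≤ B) (hQB : ∀ j, |(Q.coeff j : ℝ)| ≤ B) (n : ℕ)
    (hn : n < 2 * N) : |((wronskian P Q).coeff n : ℝ)| ≤ 4 * N ^ 2 * B ^ 2 := by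
  have hB : 0 ≤ B := (abs_nonneg _).trans (hPB 0)
  have hder : ∀ {R : ℤ[X]}, R.natDegree < N → (∀ j, |(R.coeff j : ℝ)| ≤ B) →
      ∀ j, |((derivative R).coeff j : ℝ)| ≤ N * B := by
    intro R hR hRB j
    rw [coeff_derivative]
    push_cast
    rw [abs_mul]
    by_cases hj : j + 1 < N
    · have h1 : |(j : ℝ) + 1| ≤ N := by
        rw [abs_of_nonneg (by positivity)]
        exact_mod_cast hj.le
      rw [mul_comm]
      exact mul_le_mul h1 (hRB _) (abs_nonneg _) (by positivity)
    · rw [coeff_eq_zero_of_natDegree_lt (by omega)]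
      simp
      positivity
  have hmul : ∀ {R S : ℤ[X]}, (∀ j, |(R.coeff j : ℝ)| ≤ B) → (∀ j, |(S.coeff j : ℝ)| ≤ N * B) →
      |((R * S).coeff n : ℝ)| ≤ 2 * N ^ 2 * B ^ 2 := by
    intro R S hR hS
    rw [coeff_mul]
    push_cast
    refine (abs_sum_le_sum_abs _ _).trans ((sum_le_sum fun x _ => ?_).trans
      (b := ∑ x ∈ antidiagonal n, N * B ^ 2) ?_)
    · rw [abs_mul]
      calc _ ≤ B * (N * B) := mul_le_mul (hR _) (hS _) (abs_nonneg _) hB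
        _ = _ := by ring
    · rw [sum_const, Nat.card_antidiagonal, nsmul_eq_mul]
      have : ((n + 1 : ℕ) : ℝ) ≤ 2 * N := by exact_mod_cast hn
      calc _ ≤ 2 * N * (N * B ^ 2) := by gcongr
        _ = _ := by ring
  rw [wronskian, coeff_sub, mul_comm (derivative P)]
  push_cast
  have h1 := hmul hPB (hder hQ hQB)
  have h2 := hmul hQB (hder hP hPB)
  calc _ ≤ _ := abs_sub _ _
    _ ≤ 2 * N ^ 2 * B ^ 2 + 2 * N ^ 2 * B ^ 2 := add_le_add h1 h2
    _ = _ := by ring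

/-- Gauss's lemma bounds the multiplicity of a rational root of an integer polynomial. -/
theorem Polynomial.den_pow_dvd_leadingCoeff {W : ℤ[X]} {r : ℚ} {s : ℕ}
    (h : (X - C r) ^ s ∣ W.map (Int.castRingHom ℚ)) : (r.den : ℤ) ^ s ∣ W.leadingCoeff := by
  have hr : (r.den : ℚ) ≠ 0 := by exact_mod_cast r.den_nz
  set p : ℤ[X] := C (r.den : ℤ) * X - C r.num with hp
  have hprim : p.IsPrimitive := by
    intro a ha
    rw [C_dvd_iff_dvd_coeff] at ha
    have h0 := ha 0
    have h1 := ha 1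
    simp [hp, -Int.cast_eq, -eq_intCast] at h0 h1
    have : IsCoprime r.num (r.den : ℤ) := by
      rw [Int.isCoprime_iff_nat_coprime]; simpa using r.reduced
    exact this.isUnit_of_dvd' h0 h1
  have hprimpow : ∀ k, (p ^ k).IsPrimitive := fun k => by
    induction k with
    | zero => simp
    | succ k ih => rw [pow_succ]; exact ih.mul hprim
  have hmap : p.map (Int.castRingHom ℚ) = C (r.den : ℚ) * (X - C r) := by
    rw [hp, mul_sub, ← C_mul, Rat.den_mul_eq_num]
    simp
  have hdvd : p ^ s ∣ W := by
    refine (hprimpow s).dvd_of_fraction_map_dvd_fraction_map (K := ℚ) ?_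
    change (p ^ s).map (Int.castRingHom ℚ) ∣ W.map (Int.castRingHom ℚ)
    rw [Polynomial.map_pow, hmap, mul_pow, ← C_pow]
    exact (IsUnit.mul_left_dvd (isUnit_C.2 (pow_ne_zero s hr).isUnit)).2 h
  have hlead : p.leadingCoeff = r.den := by
    have hd : (r.den : ℤ) ≠ 0 := by exact_mod_cast r.den_nz
    rw [hp, sub_eq_add_neg, ← C_neg, leadingCoeff_linear hd]
  have := leadingCoeff_dvd_leadingCoeff hdvd
  rwa [leadingCoeff_pow, hlead] at this

/-- Some low-order derivative of `P - r₂ Q` at `r₁` does not vanish. -/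
theorem exists_coeff_taylor_ne_zero {P Q : ℤ[X]} (hW : wronskian P Q ≠ 0) {r₁ : ℚ} (r₂ : ℚ)
    {s : ℕ} (hs : |(wronskian P Q).leadingCoeff| < (r₁.den : ℤ) ^ s) :
    ∃ l ≤ s, (taylor r₁ (P.map (Int.castRingHom ℚ) - C r₂ * Q.map (Int.castRingHom ℚ))).coeff l
      ≠ 0 := by
  by_contra! h
  set S := P.map (Int.castRingHom ℚ) - C r₂ * Q.map (Int.castRingHom ℚ) with hS
  have hdvd : (X - C r₁) ^ (s + 1) ∣ S :=
    (X_sub_C_pow_dvd_iff_coeff_taylor _ _ _).2 fun l hl => h l (Nat.lt_succ_iff.1 hl)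
  have hdvd' : (X - C r₁) ^ s ∣ derivative S := by
    simpa using pow_sub_one_dvd_derivative_of_pow_dvd hdvd
  have hWS : (wronskian P Q).map (Int.castRingHom ℚ) =
      S * (derivative Q).map (Int.castRingHom ℚ) - derivative S * Q.map (Int.castRingHom ℚ) := by
    rw [hS, derivative_sub, derivative_C_mul, wronskian, Polynomial.map_sub, Polynomial.map_mul,
      Polynomial.map_mul, derivative_map, derivative_map]
    ring
  have hd : (X - C r₁) ^ s ∣ (wronskian P Q).map (Int.castRingHom ℚ) := by
    rw [hWS]
    exact dvd_sub (((pow_dvd_pow _ s.le_succ).trans hdvd).mul_right _) (hdvd'.mul_right _)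
  have := Int.le_of_dvd (abs_pos.2 (leadingCoeff_ne_zero.2 hW))
    ((dvd_abs _ _).2 (den_pow_dvd_leadingCoeff hd))
  omega

theorem Polynomial.one_le_abs_coeff_taylor {P Q : ℤ[X]} {N : ℕ} (hP : P.natDegree < N)
    (hQ : Q.natDegree < N) {r₁ r₂ : ℚ} {l : ℕ}
    (h : (taylor r₁ (P.map (Int.castRingHom ℚ) - C r₂ * Q.map (Int.castRingHom ℚ))).coeff l ≠ 0) :
    1 ≤ (r₁.den : ℚ) ^ N * r₂.den *
      |(taylor r₁ (P.map (Int.castRingHom ℚ) - C r₂ * Q.map (Int.castRingHom ℚ))).coeff l| := by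
  set S := P.map (Int.castRingHom ℚ) - C r₂ * Q.map (Int.castRingHom ℚ) with hS
  have h1 : (0 : ℚ) < r₁.den := by exact_mod_cast r₁.pos
  have h2 : (0 : ℚ) < r₂.den := by exact_mod_cast r₂.pos
  have hSN : S.natDegree < N := by
    refine (natDegree_sub_le _ _).trans_lt (max_lt (natDegree_map_le.trans_lt hP) ?_)
    exact (natDegree_C_mul_le _ _).trans_lt (natDegree_map_le.trans_lt hQ)
  have hint : (r₁.den : ℚ) ^ N * r₂.den * (taylor r₁ S).coeff l =
      ((∑ j ∈ range N, (j.choose l : ℤ) * (P.coeff j * r₂.den - r₂.num * Q.coeff j) *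
        (r₁.num ^ (j - l) * (r₁.den : ℤ) ^ (N - (j - l))) : ℤ) : ℚ) := by
    rw [coeff_taylor_eq_sum _ hSN, mul_sum]
    push_cast
    refine sum_congr rfl fun j hj => ?_
    have hj : j < N := mem_range.1 hj
    have e1 : (r₁.den : ℚ) ^ N = r₁.den ^ (j - l) * r₁.den ^ (N - (j - l)) := by
      rw [← pow_add]; congr 1; omega
    rw [hS, coeff_sub, coeff_C_mul, coeff_map, coeff_map, e1, ← Rat.den_mul_eq_num r₁,
      ← Rat.den_mul_eq_num r₂, mul_pow]
    simp only [eq_intCast]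
    ring
  rw [← abs_of_pos (show (0 : ℚ) < r₁.den ^ N * r₂.den by positivity), ← abs_mul, hint]
  have hne : (∑ j ∈ range N, (j.choose l : ℤ) * (P.coeff j * r₂.den - r₂.num * Q.coeff j) *
        (r₁.num ^ (j - l) * (r₁.den : ℤ) ^ (N - (j - l))) : ℤ) ≠ 0 := by
    intro h0
    rw [h0, Int.cast_zero] at hint
    exact mul_ne_zero (by positivity) h hint
  exact_mod_cast Int.one_le_abs hne

/-- Thue's gap principle for two rational approximations of an algebraic integer of degree `4`. -/
theorem exists_thue_gap {α : ℝ} {b : Fin 4 → ℤ} (hα : α ^ 4 = ∑ i, b i * α ^ (i : ℕ))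
    (hint : IsIntegral ℚ α) (h4 : (minpoly ℚ α).natDegree = 4) :
    ∃ E : ℝ, 1 ≤ E ∧ ∀ s : ℕ, 1 ≤ s → ∀ r₁ r₂ : ℚ, |α - r₁| ≤ 1 → E < r₁.den →
      ∃ l ≤ s, 1 ≤ E ^ s * ((r₁.den : ℝ) ^ (40 * s) * r₂.den *
        (|α - r₁| ^ (16 * s - l) + |α - r₂|)) := by
  obtain ⟨H, hH1, hH⟩ := exists_auxiliary_polynomials hα
  set R : ℝ := |α| + 1 with hR
  have hR1 : 1 ≤ R := by rw [hR]; linarith [abs_nonneg α]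
  have hone : ∀ n : ℕ, (1 : ℝ) ≤ 2 ^ n := fun n => one_le_pow₀ (by norm_num)
  have hRone : ∀ n : ℕ, (1 : ℝ) ≤ R ^ n := fun n => one_le_pow₀ hR1
  refine ⟨2 ^ 160 * R ^ 80 * H ^ 2, ?_, fun s hs r₁ r₂ h₁ hE => ?_⟩
  · exact one_le_mul_of_one_le_of_one_le (one_le_mul_of_one_le_of_one_le (hone _) (hRone _))
      (one_le_pow₀ hH1)
  obtain ⟨P, Q, h0, hP, hQ, hPH, hQH, hdvd⟩ := hH s hs
  have hW := wronskian_ne_zero_of_X_sub_C_pow_dvd hint h4 h0 (by omega) (by omega) hdvd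
  set N := 40 * s with hN
  clear_value N
  have hN2 : (N : ℝ) ≤ 2 ^ N := by exact_mod_cast (Nat.lt_two_pow_self (n := N)).le
  have hHs : 1 ≤ H ^ s := one_le_pow₀ hH1
  have hlead : |(wronskian P Q).leadingCoeff| < (r₁.den : ℤ) ^ s := by
    have hb := abs_coeff_wronskian_le hP hQ hPH hQH (wronskian P Q).natDegree
      ((natDegree_wronskian_lt_add hW).trans_le (by omega))
    have : |((wronskian P Q).leadingCoeff : ℝ)| < (r₁.den : ℝ) ^ s := by
      calc _ ≤ 4 * (N : ℝ) ^ 2 * (H ^ s) ^ 2 := hb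
        _ ≤ 2 ^ 2 * (2 ^ N) ^ 2 * (H ^ s) ^ 2 := by gcongr; norm_num
        _ = 2 ^ (2 + N * 2) * (H ^ 2) ^ s := by rw [pow_add, pow_mul]; ring
        _ ≤ 2 ^ (160 * s) * (H ^ 2) ^ s := by
          gcongr
          · norm_num
          · omega
        _ = (2 ^ 160 * 1 * H ^ 2) ^ s := by rw [mul_one, mul_pow, pow_mul]
        _ ≤ (2 ^ 160 * R ^ 80 * H ^ 2) ^ s := by
          have := hRone 80
          gcongr
        _ < _ := pow_lt_pow_left₀ hE (by positivity) (by omega)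
    exact_mod_cast this
  obtain ⟨l, hl, hne⟩ := exists_coeff_taylor_ne_zero hW r₂ hlead
  refine ⟨l, hl, ?_⟩
  have hlow := one_le_abs_coeff_taylor hP hQ hne
  set v := (taylor r₁ (P.map (Int.castRingHom ℚ) - C r₂ * Q.map (Int.castRingHom ℚ))).coeff l
  set PR := P.map (Int.castRingHom ℝ) with hPR
  set QR := Q.map (Int.castRingHom ℝ) with hQR
  set S := PR - C α * QR with hS
  have hcomp : (Rat.castHom ℝ).comp (Int.castRingHom ℚ) = Int.castRingHom ℝ := RingHom.ext_int _ _
  have hv : (v : ℝ) = (taylor (r₁ - α) (taylor α S)).coeff l +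
      (α - r₂) * (taylor (r₁ : ℝ) QR).coeff l := by
    have e1 : (v : ℝ) = (taylor (r₁ : ℝ) (PR - C (r₂ : ℝ) * QR)).coeff l := by
      change Rat.castHom ℝ v = _
      rw [← coeff_map, map_taylor, Polynomial.map_sub, Polynomial.map_mul, map_C,
        Polynomial.map_map, Polynomial.map_map, hcomp]
      rfl
    have e2 : PR - C (r₂ : ℝ) * QR = S + C (α - r₂) * QR := by
      rw [hS, C_sub]; ring
    rw [e1, e2, map_add, taylor_mul, taylor_C, coeff_add, coeff_C_mul, taylor_taylor,
      sub_add_cancel]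
  have hPN : PR.natDegree < N := natDegree_map_le.trans_lt hP
  have hQN : QR.natDegree < N := natDegree_map_le.trans_lt hQ
  have hSN : S.natDegree < N := (natDegree_sub_le _ _).trans_lt
    (max_lt hPN ((natDegree_C_mul_le _ _).trans_lt hQN))
  have hQRc : ∀ j, |QR.coeff j| ≤ H ^ s := fun j => by simpa [hQR] using hQH j
  have hSc : ∀ j, |S.coeff j| ≤ R * H ^ s := fun j => by
    rw [hS, coeff_sub, coeff_C_mul]
    refine (abs_sub _ _).trans ?_
    rw [abs_mul, hR, add_mul, one_mul, add_comm]
    gcongr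
    · exact hQRc j
    · simpa [hPR] using hPH j
  have hpow : ∀ {x : ℝ}, |x| ≤ R → ∀ k < N, ∀ i, |x| ^ (k - i) ≤ R ^ N := fun hx k hk i =>
    (pow_le_pow_left₀ (abs_nonneg _) hx _).trans (pow_le_pow_right₀ hR1 (by omega))
  have hαR : |α| ≤ R := by rw [hR]; linarith
  have hrR : |(r₁ : ℝ)| ≤ R := by
    have := abs_sub_abs_le_abs_sub (r₁ : ℝ) α
    rw [abs_sub_comm] at this
    rw [hR]; linarith
  have hT : ∀ j, |(taylor α S).coeff j| ≤ N * (2 ^ N * (R * H ^ s) * R ^ N) := fun j =>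
    abs_coeff_taylor_le hSN hSc (fun k hk _ => hpow hαR k hk j) (by positivity)
  have hT0 := (X_sub_C_pow_dvd_iff_coeff_taylor _ _ _).1 hdvd
  have hA : |(taylor (r₁ - α) (taylor α S)).coeff l| ≤
      N * (2 ^ N * (N * (2 ^ N * (R * H ^ s) * R ^ N)) * |α - r₁| ^ (16 * s - l)) := by
    refine abs_coeff_taylor_le (by rwa [natDegree_taylor]) hT (fun k hk hk0 => ?_) (by positivity)
    rw [abs_sub_comm]
    refine pow_le_pow_of_le_one (abs_nonneg _) h₁ ?_
    have : 16 * s ≤ k := by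
      by_contra! hlt
      exact hk0 (hT0 k hlt)
    omega
  have hB : |(taylor (r₁ : ℝ) QR).coeff l| ≤ N * (2 ^ N * H ^ s * R ^ N) :=
    abs_coeff_taylor_le hQN hQRc (fun k hk _ => hpow hrR k hk l) (by positivity)
  have hRN : R ≤ R ^ N := le_self_pow₀ hR1 (by omega)
  have hE1 : N * (2 ^ N * (N * (2 ^ N * (R * H ^ s) * R ^ N))) ≤
      (2 ^ 160 * R ^ 80 * H ^ 2) ^ s := by
    calc N * (2 ^ N * (N * (2 ^ N * (R * H ^ s) * R ^ N)))
        ≤ 2 ^ N * (2 ^ N * (2 ^ N * (2 ^ N * (R ^ N * (H ^ s * H ^ s)) * R ^ N))) := by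
          have : H ^ s ≤ H ^ s * H ^ s := le_mul_of_one_le_left (by positivity) hHs
          gcongr
      _ = _ := by
          rw [mul_pow, mul_pow, ← pow_mul, ← pow_mul, ← pow_mul, show 160 * s = N + N + N + N by omega,
            show 80 * s = N + N by omega, show 2 * s = s + s by omega]
          simp only [pow_add]
          ring
  have hE2 : N * (2 ^ N * H ^ s * R ^ N) ≤ (2 ^ 160 * R ^ 80 * H ^ 2) ^ s := by
    refine le_trans ?_ hE1
    have hN1 : (1 : ℝ) ≤ N := by exact_mod_cast (show 1 ≤ N by omega)
    calc (N : ℝ) * (2 ^ N * H ^ s * R ^ N)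
        = N * (1 * (1 * (2 ^ N * (1 * H ^ s) * R ^ N))) := by ring
      _ ≤ _ := by
        have := hone N
        gcongr
  set F := (2 ^ 160 * R ^ 80 * H ^ 2) ^ s
  have hvF : |(v : ℝ)| ≤ F * (|α - r₁| ^ (16 * s - l) + |α - r₂|) := by
    rw [hv]
    refine (abs_add_le _ _).trans ?_
    rw [mul_add, abs_mul, mul_comm |α - (r₂ : ℝ)|]
    refine add_le_add (hA.trans ?_) ?_
    · rw [← mul_assoc, ← mul_assoc]
      refine mul_le_mul_of_nonneg_right ?_ (by positivity)
      rwa [mul_assoc]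
    · exact mul_le_mul_of_nonneg_right (hB.trans hE2) (abs_nonneg _)
  have hlowR : (1 : ℝ) ≤ (r₁.den : ℝ) ^ N * r₂.den * |(v : ℝ)| := by exact_mod_cast hlow
  calc (1 : ℝ) ≤ (r₁.den : ℝ) ^ N * r₂.den * |(v : ℝ)| := hlowR
    _ ≤ (r₁.den : ℝ) ^ N * r₂.den * (F * (|α - r₁| ^ (16 * s - l) + |α - r₂|)) := by gcongr
    _ = _ := by ring

theorem Rat.finite_of_abs_le_of_den_le {S : Set ℚ} {R : ℝ} {D : ℕ} (hR : ∀ r ∈ S, |(r : ℝ)| ≤ R)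
    (hD : ∀ r ∈ S, r.den ≤ D) : S.Finite := by
  refine Set.Finite.of_finite_image (f := fun r : ℚ => (r.num, r.den))
    (((Set.finite_Icc (-⌈R * D⌉) ⌈R * D⌉).prod (Set.finite_Iic D)).subset ?_) ?_
  · rintro _ ⟨r, hr, rfl⟩
    refine ⟨?_, hD r hr⟩
    rw [Set.mem_Icc, ← abs_le]
    have hd : (r.den : ℝ) ≤ D := by exact_mod_cast hD r hr
    have : (r.num : ℝ) = r.den * r := by exact_mod_cast (Rat.den_mul_eq_num r).symm
    have h2 : |(r.num : ℝ)| ≤ R * D := by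
      rw [this, abs_mul, Nat.abs_cast, mul_comm]
      exact mul_le_mul (hR r hr) hd (by positivity) ((abs_nonneg _).trans (hR r hr))
    exact_mod_cast h2.trans (Int.le_ceil _)
  · intro r _ r' _ h
    simp only [Prod.mk.injEq] at h
    exact Rat.ext h.1 h.2

theorem exists_den_gt_of_infinite {α C : ℝ} (hC : 0 ≤ C)
    (h : {r : ℚ | |α - r| ≤ C / (r.den : ℝ) ^ 4}.Infinite) (D : ℕ) :
    ∃ r : ℚ, |α - r| ≤ C / (r.den : ℝ) ^ 4 ∧ D < r.den := by
  by_contra! hD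
  refine h (Rat.finite_of_abs_le_of_den_le (R := |α| + C) (fun r hr => ?_) hD)
  have h1 : (1 : ℝ) ≤ (r.den : ℝ) ^ 4 := one_le_pow₀ (by exact_mod_cast r.pos)
  have h2 : C / (r.den : ℝ) ^ 4 ≤ C := div_le_self hC h1
  have h3 := abs_sub_abs_le_abs_sub (r : ℝ) α
  rw [abs_sub_comm] at h3
  have h4 : |α - r| ≤ C / (r.den : ℝ) ^ 4 := hr
  linarith

/-- **Thue's theorem** for algebraic integers of degree `4`, with exponent `4`. -/
theorem finite_approx_of_isIntegral {α : ℝ} (hα : IsIntegral ℤ α)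
    (h4 : (minpoly ℚ α).natDegree = 4) {C : ℝ} (hC : 1 ≤ C) :
    {r : ℚ | |α - r| ≤ C / (r.den : ℝ) ^ 4}.Finite := by
  by_contra hinf
  have hmin : minpoly ℚ α = (minpoly ℤ α).map (algebraMap ℤ ℚ) :=
    minpoly.isIntegrallyClosed_eq_field_fractions' ℚ hα
  have hmonic := minpoly.monic hα
  have hdeg : (minpoly ℤ α).natDegree = 4 := by
    rw [← h4, hmin, hmonic.natDegree_map]
  have hrel : α ^ 4 = ∑ i : Fin 4, ((-(minpoly ℤ α).coeff i : ℤ) : ℝ) * α ^ (i : ℕ) := by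
    have h := minpoly.aeval ℤ α
    have hc : (minpoly ℤ α).coeff 4 = 1 := by rw [← hdeg]; exact hmonic
    rw [aeval_eq_sum_range, hdeg, sum_range_succ, hc, sum_range, one_smul] at h
    rw [eq_neg_of_add_eq_zero_right h, ← sum_neg_distrib]
    refine sum_congr rfl fun i _ => ?_
    rw [zsmul_eq_mul]
    push_cast
    ring
  obtain ⟨E, hE1, hE⟩ := exists_thue_gap hrel (hα.tower_top) h4
  obtain ⟨D, hD⟩ := exists_nat_gt (2 * (E * C ^ 16))
  have hC16 : (1 : ℝ) ≤ C ^ 16 := one_le_pow₀ hC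
  obtain ⟨r₁, hr₁, hq₁⟩ := exists_den_gt_of_infinite (by linarith) hinf D
  obtain ⟨r₂, hr₂, hq₂⟩ := exists_den_gt_of_infinite (by linarith) hinf ((r₁.den ^ 16) ^ 6)
  have hq₁R : 2 * (E * C ^ 16) < r₁.den := hD.trans (by exact_mod_cast hq₁)
  have hEC : E ≤ E * C ^ 16 := le_mul_of_one_le_right (by linarith) hC16
  have hCC : C ≤ E * C ^ 16 :=
    (le_self_pow₀ hC (by norm_num)).trans (le_mul_of_one_le_left (by linarith) hE1)
  have hden : 1 < r₁.den := by
    have : (1 : ℝ) < r₁.den := by linarith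
    exact_mod_cast this
  have hb : 1 < r₁.den ^ 16 := Nat.one_lt_pow (by norm_num) hden
  set s := Nat.log (r₁.den ^ 16) r₂.den with hs
  have hs6 : 6 ≤ s := (Nat.le_log_iff_pow_le hb r₂.den_nz).2 hq₂.le
  have hlo : (r₁.den ^ 16) ^ s ≤ r₂.den := Nat.pow_log_le_self _ r₂.den_nz
  have hhi : r₂.den < (r₁.den ^ 16) ^ (s + 1) := Nat.lt_pow_succ_log_self hb _
  set q : ℝ := (r₁.den : ℝ) with hq
  set t : ℝ := (r₂.den : ℝ) with ht
  have hq1 : 1 < q := by rw [hq]; exact_mod_cast hden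
  have hlo' : q ^ (16 * s) ≤ t := by rw [pow_mul, hq, ht]; exact_mod_cast hlo
  have hhi' : t ≤ q ^ (16 * s + 16) := by
    rw [show 16 * s + 16 = 16 * (s + 1) by ring, pow_mul, hq, ht]; exact_mod_cast hhi.le
  have hq0 : 0 < q := by linarith
  have ht0 : 0 < t := lt_of_lt_of_le (by positivity) hlo'
  have hr₁' : |α - r₁| ≤ C / q ^ 4 := hr₁
  have hr₂' : |α - r₂| ≤ C / t ^ 4 := hr₂
  have hclose : |α - r₁| ≤ 1 := by
    refine hr₁'.trans ((div_le_one (by positivity)).2 ?_)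
    exact (show C ≤ q by linarith).trans (le_self_pow₀ hq1.le (by norm_num))
  obtain ⟨l, hl, hmain⟩ := hE s (by omega) r₁ r₂ hclose (by linarith)
  have hx : |α - r₁| ^ (16 * s - l) ≤ (C ^ 16) ^ s / q ^ (60 * s) := by
    calc |α - r₁| ^ (16 * s - l) ≤ (C / q ^ 4) ^ (16 * s - l) := by gcongr
      _ = C ^ (16 * s - l) / q ^ (4 * (16 * s - l)) := by rw [div_pow, ← pow_mul]
      _ ≤ C ^ (16 * s) / q ^ (60 * s) :=
        div_le_div₀ (by positivity) (pow_le_pow_right₀ hC (by omega)) (by positivity)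
          (pow_le_pow_right₀ hq1.le (by omega))
      _ = _ := by rw [pow_mul]
  have hy : |α - r₂| ≤ (C ^ 16) ^ s / t ^ 4 := by
    refine hr₂'.trans ?_
    gcongr
    rw [← pow_mul]
    exact le_self_pow₀ hC (by omega)
  have h1 : q ^ (40 * s) * t * ((C ^ 16) ^ s / q ^ (60 * s)) ≤ (C ^ 16) ^ s / q ^ s := by
    rw [mul_div_assoc', div_le_div_iff₀ (by positivity) (by positivity)]
    calc q ^ (40 * s) * t * (C ^ 16) ^ s * q ^ s
        ≤ q ^ (40 * s) * q ^ (16 * s + 16) * (C ^ 16) ^ s * q ^ s := by gcongr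
      _ = (C ^ 16) ^ s * q ^ (40 * s + (16 * s + 16) + s) := by simp only [pow_add]; ring
      _ ≤ (C ^ 16) ^ s * q ^ (60 * s) := by
        gcongr
        · exact hq1.le
        · omega
  have h2 : q ^ (40 * s) * t * ((C ^ 16) ^ s / t ^ 4) ≤ (C ^ 16) ^ s / q ^ s := by
    rw [mul_div_assoc', div_le_div_iff₀ (by positivity) (by positivity)]
    calc q ^ (40 * s) * t * (C ^ 16) ^ s * q ^ s
        = (C ^ 16) ^ s * (t * q ^ (40 * s + s)) := by rw [pow_add]; ring
      _ ≤ (C ^ 16) ^ s * (t * q ^ (16 * s * 3)) := by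
        gcongr
        · exact hq1.le
        · omega
      _ ≤ (C ^ 16) ^ s * (t * t ^ 3) := by rw [pow_mul]; gcongr
      _ = _ := by ring
  have hfin : E ^ s * (q ^ (40 * s) * t * (|α - r₁| ^ (16 * s - l) + |α - r₂|)) ≤
      2 * (E * C ^ 16 / q) ^ s := by
    calc _ ≤ E ^ s * (q ^ (40 * s) * t *
          ((C ^ 16) ^ s / q ^ (60 * s) + (C ^ 16) ^ s / t ^ 4)) := by gcongr
      _ ≤ E ^ s * ((C ^ 16) ^ s / q ^ s + (C ^ 16) ^ s / q ^ s) := by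
        rw [mul_add]; gcongr
      _ = _ := by rw [div_pow, mul_pow]; ring
  have hlt : E * C ^ 16 / q < 1 / 2 := by
    rw [div_lt_div_iff₀ hq0 (by norm_num)]; linarith
  have hle : (E * C ^ 16 / q) ^ s ≤ E * C ^ 16 / q :=
    pow_le_of_le_one (by positivity) (by linarith) (by omega)
  linarith

theorem natDegree_minpoly_le_natDegree_minpoly_mul {α : ℝ} {c : ℚ} (hc : c ≠ 0)
    (h : IsIntegral ℚ ((c : ℝ) * α)) :
    (minpoly ℚ α).natDegree ≤ (minpoly ℚ ((c : ℝ) * α)).natDegree := by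
  have hdeg : (C c * X : ℚ[X]).natDegree = 1 := natDegree_C_mul_X c hc
  have hne : (minpoly ℚ ((c : ℝ) * α)).comp (C c * X) ≠ 0 := by
    intro h0
    rw [comp_eq_zero_iff] at h0
    rcases h0 with h0 | h0
    · exact minpoly.ne_zero h h0
    · have := h0.2
      rw [this, natDegree_C] at hdeg
      norm_num at hdeg
  have hroot : aeval α ((minpoly ℚ ((c : ℝ) * α)).comp (C c * X)) = 0 := by
    rw [aeval_comp]
    simp
  have := natDegree_le_of_dvd (minpoly.dvd ℚ α hroot) hne
  rwa [natDegree_comp, hdeg, mul_one] at this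

theorem finite_approx_of_natDegree_eq_four {α : ℝ} (hα : IsAlgebraic ℤ α)
    (h4 : (minpoly ℚ α).natDegree = 4) (C : ℝ) :
    {r : ℚ | |α - r| ≤ C / (r.den : ℝ) ^ 4}.Finite := by
  obtain ⟨y, hy0, hint⟩ := hα.exists_integral_multiple
  have hy0' : (y : ℚ) ≠ 0 := by exact_mod_cast hy0
  have hβ : y • α = ((y : ℚ) : ℝ) * α := by rw [zsmul_eq_mul]; norm_num
  rw [hβ] at hint
  have hintQ : IsIntegral ℚ (((y : ℚ) : ℝ) * α) := hint.tower_top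
  have hαi : IsIntegral ℚ α := by
    by_contra hn
    rw [minpoly.eq_zero hn] at h4
    simp at h4
  have hback : (((y : ℚ)⁻¹ : ℚ) : ℝ) * (((y : ℚ) : ℝ) * α) = α := by
    have : ((y : ℚ) : ℝ) ≠ 0 := by exact_mod_cast hy0'
    push_cast at this ⊢
    field_simp
  have hdeg : (minpoly ℚ (((y : ℚ) : ℝ) * α)).natDegree = 4 := by
    refine le_antisymm ?_ (h4 ▸ natDegree_minpoly_le_natDegree_minpoly_mul hy0' hintQ)
    have := natDegree_minpoly_le_natDegree_minpoly_mul (α := ((y : ℚ) : ℝ) * α) (inv_ne_zero hy0')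
      (by rwa [hback])
    rwa [hback, h4] at this
  have hfin := finite_approx_of_isIntegral hint hdeg (le_max_left 1 (|(y : ℝ)| * C))
  refine Set.Finite.of_finite_image (f := fun r : ℚ => (y : ℚ) * r) (hfin.subset ?_)
    ((mul_right_injective₀ hy0').injOn)
  rintro _ ⟨r, hr, rfl⟩
  have hr : |α - r| ≤ C / (r.den : ℝ) ^ 4 := hr
  have hden : ((y : ℚ) * r).den ≤ r.den :=
    Nat.le_of_dvd r.pos (by simpa using Rat.mul_den_dvd (y : ℚ) r)
  have hp : (0 : ℝ) < (((y : ℚ) * r).den : ℝ) := by exact_mod_cast Rat.pos _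
  have hp' : (0 : ℝ) < (r.den : ℝ) := by exact_mod_cast Rat.pos _
  have hdenR : (((y : ℚ) * r).den : ℝ) ≤ r.den := by exact_mod_cast hden
  change |((y : ℚ) : ℝ) * α - (((y : ℚ) * r : ℚ) : ℝ)| ≤ _
  rw [Rat.cast_mul, ← mul_sub, abs_mul, Rat.cast_intCast]
  calc |(y : ℝ)| * |α - r| ≤ |(y : ℝ)| * (C / (r.den : ℝ) ^ 4) := by gcongr
    _ = |(y : ℝ)| * C / (r.den : ℝ) ^ 4 := by ring
    _ ≤ max 1 (|(y : ℝ)| * C) / (r.den : ℝ) ^ 4 := by gcongr; exact le_max_right _ _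
    _ ≤ _ := by gcongr

/-- A real root of a nonzero integer polynomial of degree at most `4` has only finitely many
rational approximations with exponent `4`. -/
theorem finite_approx_of_root {f : ℤ[X]} (hf : f ≠ 0) (hdeg : f.natDegree ≤ 4) {α : ℝ}
    (hα : aeval α f = 0) {C : ℝ} (hC : 0 ≤ C) :
    {r : ℚ | |α - r| ≤ C / (r.den : ℝ) ^ 4}.Finite := by
  have halg : IsAlgebraic ℤ α := ⟨f, hf, hα⟩
  have hint : IsIntegral ℚ α := (halg.extendScalars (Int.cast_injective (α := ℚ))).isIntegral
  by_cases h4 : (minpoly ℚ α).natDegree = 4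
  · exact finite_approx_of_natDegree_eq_four halg h4 C
  by_contra hinf
  by_cases hirr : Irrational α
  · have hle : (minpoly ℚ α).natDegree ≤ 4 := by
      have hroot : aeval α (f.map (algebraMap ℤ ℚ)) = 0 := by rwa [aeval_map_algebraMap]
      have hne : f.map (algebraMap ℤ ℚ) ≠ 0 := (Polynomial.map_ne_zero_iff Int.cast_injective).2 hf
      exact (natDegree_le_of_dvd (minpoly.dvd ℚ α hroot) hne).trans (natDegree_map_le.trans hdeg)
    set g := IsLocalization.integerNormalization (nonZeroDivisors ℤ) (minpoly ℚ α) with hg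
    have hg0 : g ≠ 0 := fun h => minpoly.ne_zero hint
      ((IsLocalization.integerNormalization_eq_zero_iff le_rfl _).1 h)
    have hgdeg : g.natDegree ≤ 3 := by
      refine (natDegree_le_iff_coeff_eq_zero.2 fun n hn => ?_ : g.natDegree ≤
        (minpoly ℚ α).natDegree).trans (by omega)
      by_contra h
      have := IsLocalization.integerNormalization_support _ _ (mem_support_iff.2 h)
      exact mem_support_iff.1 this (coeff_eq_zero_of_natDegree_lt hn)
    have hgα : eval α (g.map (algebraMap ℤ ℝ)) = 0 := by
      rw [eval_map, ← aeval_def]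
      exact IsLocalization.integerNormalization_aeval_eq_zero _ _ (minpoly.aeval ℚ α)
    obtain ⟨A, hA0, hA⟩ := Liouville.exists_pos_real_of_irrational_root hirr hg0 hgα
    obtain ⟨n, hn⟩ := exists_nat_gt (C * A)
    obtain ⟨r, hr, hrd⟩ := exists_den_gt_of_infinite hC hinf n
    have hr1 : (1 : ℝ) ≤ r.den := by exact_mod_cast r.pos
    have hb : ((r.den - 1 : ℕ) : ℝ) + 1 = r.den := by
      have := r.pos
      exact_mod_cast Nat.sub_add_cancel this
    have hlow := hA r.num (r.den - 1)
    rw [hb, ← Rat.cast_def] at hlow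
    have hn' : C * A < r.den := hn.trans (by exact_mod_cast hrd)
    have : (r.den : ℝ) ^ g.natDegree * (|α - r| * A) < 1 := by
      calc (r.den : ℝ) ^ g.natDegree * (|α - r| * A)
          ≤ (r.den : ℝ) ^ 3 * (C / (r.den : ℝ) ^ 4 * A) := by gcongr
        _ = C * A / r.den := by field_simp
        _ < 1 := (div_lt_one (by positivity)).2 hn'
    linarith
  · simp only [Irrational, not_not] at hirr
    obtain ⟨a, rfl⟩ := hirr
    obtain ⟨n, hn⟩ := exists_nat_gt (C * a.den)
    obtain ⟨r, hr, hrd⟩ := exists_den_gt_of_infinite hC hinf (max n a.den)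
    have hne : a - r ≠ 0 := by
      intro h
      rw [sub_eq_zero.1 h] at hrd
      exact absurd (le_max_right n r.den) (not_le.2 hrd)
    have ha0 : (0 : ℝ) < a.den := by exact_mod_cast a.pos
    have hr1 : (1 : ℝ) ≤ r.den := by exact_mod_cast r.pos
    have hlow : (1 : ℝ) ≤ a.den * r.den * |(a : ℝ) - r| := by
      have h1 : (a.den : ℚ) * r.den * (a - r) = ((a.num * r.den - r.num * a.den : ℤ) : ℚ) := by
        push_cast
        rw [← Rat.den_mul_eq_num a, ← Rat.den_mul_eq_num r]
        ring
      have h2 : (1 : ℚ) ≤ |(a.den : ℚ) * r.den * (a - r)| := by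
        have h3 : (a.den : ℚ) * r.den * (a - r) ≠ 0 := by positivity
        rw [h1] at h3 ⊢
        exact_mod_cast Int.one_le_abs (by exact_mod_cast h3)
      rw [abs_mul, abs_mul, Nat.abs_cast, Nat.abs_cast] at h2
      exact_mod_cast h2
    have hn' : C * a.den < r.den := hn.trans (by exact_mod_cast (le_max_left n a.den).trans_lt hrd)
    have : (a.den : ℝ) * r.den * |(a : ℝ) - r| < 1 := by
      calc (a.den : ℝ) * r.den * |(a : ℝ) - r| ≤ a.den * r.den * (C / (r.den : ℝ) ^ 4) := by gcongr
        _ = C * a.den / (r.den : ℝ) ^ 3 := by field_simp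
        _ < 1 := (div_lt_one (by positivity)).2 (hn'.trans_le (le_self_pow₀ hr1 (by norm_num)))
    linarith

/-- The binary quartic form with coefficients `a, b, c, d, e`. -/
def quarticForm {R : Type*} [CommRing R] (a b c d e u v : R) : R :=
  a * u ^ 4 + b * u ^ 3 * v + c * u ^ 2 * v ^ 2 + d * u * v ^ 3 + e * v ^ 4

/-- `4 I ^ 3 - J ^ 2`, where `I` and `J` are the invariants of the binary quartic form with
coefficients `a, b, c, d, e`; this is 27 times the discriminant of the form. -/
def quarticDiscr {R : Type*} [CommRing R] (a b c d e : R) : R :=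
  4 * (12 * a * e - 3 * b * d + c ^ 2) ^ 3 -
    (72 * a * c * e + 9 * b * c * d - 27 * a * d ^ 2 - 27 * e * b ^ 2 - 2 * c ^ 3) ^ 2

theorem den_eq_natAbs_of_isCoprime {u v : ℤ} (hv : v ≠ 0) (h : IsCoprime u v) :
    ((u : ℚ) / v).den = v.natAbs := by
  have hc : u.natAbs.Coprime v.natAbs := Int.isCoprime_iff_gcd_eq_one.1 h
  rcases hv.lt_or_gt with hv | hv
  · have := Rat.den_div_eq_of_coprime (a := -u) (b := -v) (by omega) (by simpa using hc)
    rw [Int.cast_neg, Int.cast_neg, neg_div_neg_eq] at this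
    omega
  · have := Rat.den_div_eq_of_coprime (a := u) (b := v) hv hc
    omega

theorem isCoprime_of_quarticForm_eq_one {a b c d e u v : ℤ} (h : quarticForm a b c d e u v = 1) :
    IsCoprime u v :=
  ⟨a * u ^ 3 + b * u ^ 2 * v + c * u * v ^ 2 + d * v ^ 3, e * v ^ 3, by
    rw [← h, quarticForm]; ring⟩

theorem deriv_ne_zero_of_quarticDiscr_ne_zero {a b c d e α : ℝ} (hΔ : quarticDiscr a b c d e ≠ 0)
    (hα : quarticForm a b c d e α 1 = 0) :
    4 * a * α ^ 3 + 3 * b * α ^ 2 + 2 * c * α + d ≠ 0 := by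
  intro h
  refine hΔ ?_
  have hd : d = -(4 * a * α ^ 3 + 3 * b * α ^ 2 + 2 * c * α) := by linear_combination h
  have he : e = -(a * α ^ 4 + b * α ^ 3 + c * α ^ 2 + d * α) := by
    rw [quarticForm] at hα
    linear_combination hα
  rw [he, hd, quarticDiscr]
  ring

theorem hasDerivAt_quarticForm (a b c d e α : ℝ) :
    HasDerivAt (fun t => quarticForm a b c d e t 1)
      (4 * a * α ^ 3 + 3 * b * α ^ 2 + 2 * c * α + d) α := by
  have h := (((((hasDerivAt_pow 4 α).const_mul a).add ((hasDerivAt_pow 3 α).const_mul b)).add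
    ((hasDerivAt_pow 2 α).const_mul c)).add ((hasDerivAt_id α).const_mul d)).add
    (hasDerivAt_const α e)
  refine (h.congr_deriv ?_).congr_of_eventuallyEq (.of_forall fun t => ?_)
  · push_cast; ring
  · simp [quarticForm]

theorem exists_nhds_bound_of_quarticForm_eq_one {a b c d e : ℤ} (hΔ : quarticDiscr a b c d e ≠ 0)
    (α : ℝ) : ∃ U ∈ nhds α, ∃ M : ℕ, ∀ u v : ℤ, quarticForm a b c d e u v = 1 →
      (u / v : ℝ) ∈ U → v.natAbs ≤ M := by
  have hΔ' : quarticDiscr (a : ℝ) b c d e ≠ 0 := by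
    unfold quarticDiscr at hΔ ⊢
    exact_mod_cast hΔ
  have hval : ∀ u v : ℤ, v ≠ 0 → quarticForm a b c d e u v = 1 →
      |quarticForm (a : ℝ) b c d e (u / v) 1| = 1 / (v.natAbs : ℝ) ^ 4 := by
    intro u v hv h
    have hv' : (v : ℝ) ≠ 0 := by exact_mod_cast hv
    have h' : quarticForm (a : ℝ) b c d e u v = 1 := by
      unfold quarticForm at h ⊢
      exact_mod_cast h
    have h4 : (v.natAbs : ℝ) ^ 4 = (v : ℝ) ^ 4 := by
      rw [Nat.cast_natAbs, Int.cast_abs, Even.pow_abs (by decide)]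
    have : quarticForm (a : ℝ) b c d e (u / v) 1 = 1 / (v : ℝ) ^ 4 := by
      refine (eq_div_iff (by positivity)).2 (Eq.trans ?_ h')
      unfold quarticForm
      field_simp
    rw [this, h4, abs_of_pos (by positivity)]
  have hder := hasDerivAt_quarticForm (a : ℝ) b c d e α
  by_cases hα : quarticForm (a : ℝ) b c d e α 1 = 0
  · have hm := deriv_ne_zero_of_quarticDiscr_ne_zero hΔ' hα
    set m := 4 * (a : ℝ) * α ^ 3 + 3 * b * α ^ 2 + 2 * c * α + d
    have hm0 : 0 < |m| := abs_pos.2 hm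
    have hnear : ∀ᶠ t in nhds α, |m| / 2 * |t - α| ≤ |quarticForm (a : ℝ) b c d e t 1| := by
      filter_upwards [hder.isLittleO.def (half_pos hm0)] with t ht
      rw [hα, smul_eq_mul, sub_zero, Real.norm_eq_abs, Real.norm_eq_abs] at ht
      have := abs_sub_abs_le_abs_sub ((t - α) * m) (quarticForm (a : ℝ) b c d e t 1)
      rw [abs_sub_comm, abs_mul] at this
      linarith
    let f : ℤ[X] := C a * X ^ 4 + C b * X ^ 3 + C c * X ^ 2 + C d * X + C e
    have hf : f ≠ 0 := by
      intro h
      refine hΔ ?_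
      have h4 : a = 0 := by simpa [f, coeff_X, coeff_C, -eq_intCast] using congrArg (coeff · 4) h
      have h3 : b = 0 := by simpa [f, coeff_X, coeff_C, -eq_intCast] using congrArg (coeff · 3) h
      have h2 : c = 0 := by simpa [f, coeff_X, coeff_C, -eq_intCast] using congrArg (coeff · 2) h
      simp [quarticDiscr, h4, h3, h2]
    have hdeg : f.natDegree ≤ 4 := by simp only [f]; compute_degree
    have hroot : aeval α f = 0 := by
      simpa [f, quarticForm] using hα
    have hfin := finite_approx_of_root hf hdeg hroot (C := 2 / |m|) (by positivity)
    refine ⟨_, hnear, hfin.toFinset.sup Rat.den, fun u v huv hU => ?_⟩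
    by_cases hv : v = 0
    · simp [hv]
    rw [← den_eq_natAbs_of_isCoprime hv (isCoprime_of_quarticForm_eq_one huv)]
    refine Finset.le_sup (f := Rat.den) (hfin.mem_toFinset.2 ?_)
    rw [Set.mem_ofPred_eq, den_eq_natAbs_of_isCoprime hv (isCoprime_of_quarticForm_eq_one huv)]
    rw [Set.mem_ofPred_eq, hval u v hv huv] at hU
    rw [abs_sub_comm]
    push_cast
    calc |(u : ℝ) / v - α| = 2 / |m| * (|m| / 2 * |(u : ℝ) / v - α|) := by field_simp
      _ ≤ 2 / |m| * (1 / (v.natAbs : ℝ) ^ 4) := by gcongr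
      _ = _ := by rw [mul_one_div, Nat.cast_natAbs, Int.cast_abs]
  · have hε := half_pos (abs_pos.2 hα)
    set ε := |quarticForm (a : ℝ) b c d e α 1| / 2 with hεdef
    have hnear : ∀ᶠ t in nhds α, ε < |quarticForm (a : ℝ) b c d e t 1| :=
      hder.continuousAt.abs.eventually_const_lt (by rw [hεdef]; linarith)
    obtain ⟨M, hM⟩ := exists_nat_gt (1 / ε)
    refine ⟨_, hnear, M, fun u v huv hU => ?_⟩
    by_cases hv : v = 0
    · simp [hv]
    rw [Set.mem_ofPred_eq, hval u v hv huv] at hU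
    have hv1 : (1 : ℝ) ≤ v.natAbs := by exact_mod_cast Int.natAbs_pos.2 hv
    have h4 : (v.natAbs : ℝ) ≤ (v.natAbs : ℝ) ^ 4 := le_self_pow₀ hv1 (by norm_num)
    have h5 : (v.natAbs : ℝ) ^ 4 < 1 / ε := by
      rw [lt_div_iff₀ (by positivity)] at hU
      rw [lt_div_iff₀ hε]
      linarith
    exact_mod_cast (h4.trans_lt (h5.trans hM)).le

theorem exists_bound_of_quarticForm_eq_one {a b c d e : ℤ} (hΔ : quarticDiscr a b c d e ≠ 0) :
    ∃ M : ℕ, ∀ u v : ℤ, quarticForm a b c d e u v = 1 → |u| ≤ |v| → v.natAbs ≤ M := by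
  have hK : ∃ M : ℕ, ∀ u v : ℤ, quarticForm a b c d e u v = 1 →
      (u / v : ℝ) ∈ Set.Icc (-1 : ℝ) 1 → v.natAbs ≤ M := by
    refine isCompact_Icc.induction_on (p := fun U => ∃ M : ℕ, ∀ u v : ℤ,
      quarticForm a b c d e u v = 1 → (u / v : ℝ) ∈ U → v.natAbs ≤ M) ?_ ?_ ?_ ?_
    · exact ⟨0, by simp⟩
    · rintro s t hst ⟨M, hM⟩
      exact ⟨M, fun u v h hU => hM u v h (hst hU)⟩
    · rintro s t ⟨M, hM⟩ ⟨N, hN⟩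
      refine ⟨max M N, fun u v h hU => ?_⟩
      rcases hU with hU | hU
      · exact (hM u v h hU).trans (le_max_left _ _)
      · exact (hN u v h hU).trans (le_max_right _ _)
    · intro α _
      obtain ⟨U, hU, h⟩ := exists_nhds_bound_of_quarticForm_eq_one hΔ α
      exact ⟨U, mem_nhdsWithin_of_mem_nhds hU, h⟩
  obtain ⟨M, hM⟩ := hK
  refine ⟨M, fun u v h huv => hM u v h (abs_le.1 ?_)⟩
  rw [abs_div]
  exact div_le_one_of_le₀ (by exact_mod_cast huv) (abs_nonneg _)

/-- A quartic Thue equation with nonzero discriminant has finitely many solutions. -/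
theorem finite_quarticForm_eq_one {a b c d e : ℤ} (hΔ : quarticDiscr a b c d e ≠ 0) :
    {P : ℤ × ℤ | quarticForm a b c d e P.1 P.2 = 1}.Finite := by
  obtain ⟨M, hM⟩ := exists_bound_of_quarticForm_eq_one hΔ
  obtain ⟨N, hN⟩ := exists_bound_of_quarticForm_eq_one (a := e) (b := d) (c := c) (d := b) (e := a)
    (by unfold quarticDiscr at hΔ ⊢; convert hΔ using 1; ring)
  refine ((Set.finite_Icc (-(max M N : ℤ)) (max M N)).prod
    (Set.finite_Icc (-(max M N : ℤ)) (max M N))).subset ?_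
  rintro ⟨u, v⟩ h
  simp only [Set.mem_ofPred_eq, Set.mem_prod, Set.mem_Icc] at h ⊢
  rcases le_total |u| |v| with huv | huv
  · have := hM u v h huv
    grind
  · have := hN v u (by rw [← h]; unfold quarticForm; ring) huv
    grind

/-- The coefficients of the binary quartic form `f (p Z + p' W, q Z + q' W)`, where `f` is given by
its coefficients. -/
def quarticSubst {R : Type*} [CommRing R] (f : Fin 5 → R) (p p' q q' : R) : Fin 5 → R :=
  ![f 0 * p ^ 4 + f 1 * p ^ 3 * q + f 2 * p ^ 2 * q ^ 2 + f 3 * p * q ^ 3 + f 4 * q ^ 4,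
    4 * f 0 * p ^ 3 * p' + 3 * f 1 * p ^ 2 * p' * q + f 1 * p ^ 3 * q' +
      2 * f 2 * p * p' * q ^ 2 + 2 * f 2 * p ^ 2 * q * q' + f 3 * p' * q ^ 3 +
      3 * f 3 * p * q ^ 2 * q' + 4 * f 4 * q ^ 3 * q',
    6 * f 0 * p ^ 2 * p' ^ 2 + 3 * f 1 * p * p' ^ 2 * q + 3 * f 1 * p ^ 2 * p' * q' +
      f 2 * p' ^ 2 * q ^ 2 + 4 * f 2 * p * p' * q * q' + f 2 * p ^ 2 * q' ^ 2 +
      3 * f 3 * p' * q ^ 2 * q' + 3 * f 3 * p * q * q' ^ 2 + 6 * f 4 * q ^ 2 * q' ^ 2,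
    4 * f 0 * p * p' ^ 3 + 3 * f 1 * p * p' ^ 2 * q' + f 1 * p' ^ 3 * q +
      2 * f 2 * p * p' * q' ^ 2 + 2 * f 2 * p' ^ 2 * q * q' + f 3 * p * q' ^ 3 +
      3 * f 3 * p' * q * q' ^ 2 + 4 * f 4 * q * q' ^ 3,
    f 0 * p' ^ 4 + f 1 * p' ^ 3 * q' + f 2 * p' ^ 2 * q' ^ 2 + f 3 * p' * q' ^ 3 + f 4 * q' ^ 4]

theorem quarticForm_quarticSubst {R : Type*} [CommRing R] (f : Fin 5 → R) (p p' q q' u v : R) :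
    quarticForm (quarticSubst f p p' q q' 0) (quarticSubst f p p' q q' 1)
      (quarticSubst f p p' q q' 2) (quarticSubst f p p' q q' 3) (quarticSubst f p p' q q' 4) u v =
    quarticForm (f 0) (f 1) (f 2) (f 3) (f 4) (p * u + p' * v) (q * u + q' * v) := by
  simp [quarticSubst, quarticForm]
  ring

theorem quarticSubst_quarticSubst {R : Type*} [CommRing R] (f : Fin 5 → R)
    (a b c d a' b' c' d' : R) :
    quarticSubst (quarticSubst f a b c d) a' b' c' d' =
      quarticSubst f (a * a' + b * c') (a * b' + b * d') (c * a' + d * c') (c * b' + d * d') := by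
  ext i
  fin_cases i <;> simp [quarticSubst] <;> ring

theorem quarticSubst_one {R : Type*} [CommRing R] (f : Fin 5 → R) :
    quarticSubst f 1 0 0 1 = f := by
  ext i
  fin_cases i <;> simp [quarticSubst]

theorem intCast_quarticSubst {R : Type*} [CommRing R] (f : Fin 5 → ℤ) (p p' q q' : ℤ) (i : Fin 5) :
    ((quarticSubst f p p' q q' i : ℤ) : R) = quarticSubst (fun j => (f j : R)) p p' q q' i := by
  fin_cases i <;> simp [quarticSubst]

theorem quarticDiscr_quarticSubst {R : Type*} [CommRing R] (f : Fin 5 → R) {p p' q q' : R}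
    (hdet : p * q' - p' * q = 1) :
    quarticDiscr (quarticSubst f p p' q q' 0) (quarticSubst f p p' q q' 1)
      (quarticSubst f p p' q q' 2) (quarticSubst f p p' q q' 3) (quarticSubst f p p' q q' 4) =
    quarticDiscr (f 0) (f 1) (f 2) (f 3) (f 4) := by
  have hI : ∀ g : Fin 5 → R, g = quarticSubst f p p' q q' →
      12 * g 0 * g 4 - 3 * g 1 * g 3 + g 2 ^ 2 =
        (p * q' - p' * q) ^ 4 * (12 * f 0 * f 4 - 3 * f 1 * f 3 + f 2 ^ 2) := by
    rintro _ rfl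
    simp [quarticSubst]
    ring
  have hJ : ∀ g : Fin 5 → R, g = quarticSubst f p p' q q' →
      72 * g 0 * g 2 * g 4 + 9 * g 1 * g 2 * g 3 - 27 * g 0 * g 3 ^ 2 - 27 * g 4 * g 1 ^ 2 -
          2 * g 2 ^ 3 =
        (p * q' - p' * q) ^ 6 * (72 * f 0 * f 2 * f 4 + 9 * f 1 * f 2 * f 3 - 27 * f 0 * f 3 ^ 2 -
          27 * f 4 * f 1 ^ 2 - 2 * f 2 ^ 3) := by
    rintro _ rfl
    simp [quarticSubst]
    ring
  rw [quarticDiscr, hI _ rfl, hJ _ rfl, hdet, quarticDiscr]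
  ring

theorem abs_quarticSubst_le {f : Fin 5 → ℝ} {K r r' p p' q q' : ℝ} (hf : ∀ i, |f i| ≤ K)
    (hp : |p| ≤ r) (hq : |q| ≤ r) (hp' : |p'| ≤ r') (hq' : |q'| ≤ r') (i : Fin 5) :
    |quarticSubst f p p' q q' i| ≤ 5 * Nat.choose 4 i * K * r ^ (4 - i : ℕ) * r' ^ (i : ℕ) := by
  have hK := (abs_nonneg _).trans (hf 0)
  have hr := (abs_nonneg _).trans hp
  have hr' := (abs_nonneg _).trans hp'
  have hle : |quarticSubst f p p' q q' i| ≤ quarticSubst (fun _ => K) r r' r r' i := by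
    fin_cases i <;> simp only [quarticSubst] <;>
    · simp only [Fin.zero_eta, Fin.mk_one, Fin.reduceFinMk, Matrix.cons_val]
      repeat' refine (abs_add_le _ _).trans (add_le_add ?_ ?_)
      all_goals
        simp only [abs_mul, abs_pow, Nat.abs_ofNat]
        gcongr
        all_goals exact hf _
  refine hle.trans_eq ?_
  fin_cases i <;> simp [quarticSubst, Nat.choose] <;> ring

/-- The quartic form attached to a point `(x, y)` of `y² = x³ + A x + B`. -/
def mordellQuartic {R : Type*} [CommRing R] (A x y : R) : Fin 5 → R :=
  ![1, 0, -6 * x, -8 * y, -(3 * x ^ 2 + 4 * A)]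

theorem quarticDiscr_mordellQuartic {A B x y : ℤ} (h : y ^ 2 = x ^ 3 + A * x + B) :
    quarticDiscr (mordellQuartic A x y 0) (mordellQuartic A x y 1) (mordellQuartic A x y 2)
      (mordellQuartic A x y 3) (mordellQuartic A x y 4) =
    110592 * (-4 * A ^ 3 - 27 * B ^ 2) := by
  have hB : B = y ^ 2 - x ^ 3 - A * x := by linear_combination -h
  rw [hB]
  simp [mordellQuartic, quarticDiscr]
  ring

theorem abs_quarticSubst_mordellQuartic_le {A B x y s : ℝ} (hs : 1 ≤ s) (hx : s ^ 4 = x)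
    (hy : 0 ≤ y) (h : y ^ 2 = x ^ 3 + A * x + B) (i : Fin 5) :
    |quarticSubst (mordellQuartic A x y) s⁻¹ (-s ^ 3) 0 s i| ≤
      4 + 8 * (|A| + |B|) + 4 * (2 * |B| + |A| * (|A| + |B|)) := by
  have hs0 : 0 < s := by linarith
  have hA := abs_nonneg A
  have hB := abs_nonneg B
  have hx1 : 1 ≤ x := hx ▸ one_le_pow₀ hs
  have hss : s⁻¹ * s = 1 := inv_mul_cancel₀ hs0.ne'
  set N := |A| + |B| with hN
  set t := x ^ 2 - y * s ^ 2 with ht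
  set D := x ^ 2 + y * s ^ 2 with hD
  have hxD : x ^ 2 ≤ D := le_add_of_nonneg_right (by positivity)
  have htD : t * D = -(A * x ^ 2 + B * x) := by
    rw [ht, hD]
    linear_combination -x * h - y ^ 2 * hx
  have hlin : ∀ u v : ℝ, |u * x + v| ≤ (|u| + |v|) * x := fun u v => by
    calc |u * x + v| ≤ |u * x| + |v| := abs_add_le _ _
      _ = |u| * x + |v| := by rw [abs_mul, abs_of_pos (by linarith : 0 < x)]
      _ ≤ (|u| + |v|) * x := by nlinarith [abs_nonneg v]
  have hdiv : ∀ z Q : ℝ, |z * D| ≤ Q * x ^ 2 → |z| ≤ Q := fun z Q hz => by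
    rw [abs_mul, abs_of_pos (by nlinarith : 0 < D)] at hz
    refine le_of_mul_le_mul_right ?_ (by positivity : 0 < x ^ 2)
    exact (mul_le_mul_of_nonneg_left hxD (abs_nonneg z)).trans hz
  have htN : |t| ≤ N := by
    refine hdiv t N ?_
    rw [htD, abs_neg, show A * x ^ 2 + B * x = (A * x + B) * x by ring, abs_mul,
      abs_of_pos (by linarith : 0 < x)]
    nlinarith [hlin A B]
  have h4 : |-8 * x * t - 4 * A * x| ≤ 4 * (2 * |B| + |A| * N) := by
    refine hdiv _ _ ?_
    have h5 : (-8 * x * t - 4 * A * x) * D = 4 * x * (2 * B * x + A * t) := by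
      linear_combination -8 * x * htD - 4 * A * x * hD - 4 * A * x * ht
    rw [h5, abs_mul, abs_of_pos (by linarith : 0 < 4 * x)]
    calc 4 * x * |2 * B * x + A * t| ≤ 4 * x * ((|2 * B| + |A * t|) * x) := by
          gcongr
          exact hlin _ _
      _ ≤ 4 * x * ((2 * |B| + |A| * N) * x) := by
          rw [abs_mul, abs_mul, Nat.abs_ofNat]
          gcongr
      _ = _ := by ring
  have hnn : 0 ≤ |A| * N := by positivity
  fin_cases i
  · have : |s⁻¹ ^ 4| ≤ 1 := by
      rw [abs_of_nonneg (by positivity)]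
      exact pow_le_one₀ (by positivity) (inv_le_one_of_one_le₀ hs)
    simp [quarticSubst, mordellQuartic] at this ⊢
    linarith
  · have : quarticSubst (mordellQuartic A x y) s⁻¹ (-s ^ 3) 0 s 1 = -4 := by
      simp [quarticSubst, mordellQuartic]
      field_simp
    simp only [Fin.mk_one]
    rw [this]
    norm_num
    linarith
  · have : quarticSubst (mordellQuartic A x y) s⁻¹ (-s ^ 3) 0 s 2 = 0 := by
      simp [quarticSubst, mordellQuartic, ← hx]
      field_simp
      ring
    simp only [Fin.reduceFinMk]
    rw [this]
    norm_num
    linarith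
  · have : quarticSubst (mordellQuartic A x y) s⁻¹ (-s ^ 3) 0 s 3 = 8 * t := by
      simp [quarticSubst, mordellQuartic, ht, ← hx]
      field_simp
      ring
    simp only [Fin.reduceFinMk]
    rw [this, abs_mul, Nat.abs_ofNat]
    linarith
  · have : quarticSubst (mordellQuartic A x y) s⁻¹ (-s ^ 3) 0 s 4 = -8 * x * t - 4 * A * x := by
      simp [quarticSubst, mordellQuartic, ht, ← hx]
      ring
    simp only [Fin.reduceFinMk]
    rw [this]
    linarith

theorem exists_reduced_basis {s : ℝ} (hs : 1 ≤ s) : ∃ p p' q q' : ℤ, p * q' - p' * q = 1 ∧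
    (s * p + s ^ 3 * q) ^ 2 + (s⁻¹ * q) ^ 2 ≤ 5 ∧
    ((s * p + s ^ 3 * q) ^ 2 + (s⁻¹ * q) ^ 2) * ((s * p' + s ^ 3 * q') ^ 2 + (s⁻¹ * q') ^ 2) ≤ 9 := by
  have hs0 : 0 < s := by linarith
  obtain ⟨r, hr, hrd⟩ := Real.exists_rat_abs_sub_le_and_den_le (-s ^ 2)
    (Nat.ceil_pos.2 hs0)
  have hd0 : (0 : ℝ) < r.den := by exact_mod_cast r.pos
  have hn : (⌈s⌉₊ : ℝ) < s + 1 := Nat.ceil_lt_add_one hs0.le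
  have hn' : s ≤ ⌈s⌉₊ := Nat.le_ceil s
  have hrd' : (r.den : ℝ) ≤ ⌈s⌉₊ := by exact_mod_cast hrd
  have hcop : IsCoprime r.num (r.den : ℤ) := Int.isCoprime_iff_gcd_eq_one.2 r.reduced
  obtain ⟨m, k, hmk⟩ := hcop
  have h1 : |s * r.num + s ^ 3 * r.den| ≤ 1 := by
    have : s * r.num + s ^ 3 * r.den = -(s * r.den * (-s ^ 2 - r)) := by
      rw [Rat.cast_def r]
      field_simp
      ring
    rw [this, abs_neg, abs_mul, abs_of_pos (by positivity)]
    calc s * r.den * |-s ^ 2 - r| ≤ s * r.den * (1 / ((⌈s⌉₊ + 1) * r.den)) := by gcongr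
      _ = s / (⌈s⌉₊ + 1) := by field_simp
      _ ≤ 1 := div_le_one_of_le₀ (by linarith) (by positivity)
  have h2 : |s⁻¹ * (r.den : ℤ)| ≤ 2 := by
    rw [Int.cast_natCast, abs_of_pos (by positivity), inv_mul_le_iff₀ hs0]
    linarith
  set a := s * r.num + s ^ 3 * (r.den : ℤ) with ha
  set c := s⁻¹ * ((r.den : ℤ) : ℝ) with hc
  have hn1 : a ^ 2 + c ^ 2 ≤ 5 := by
    have h3 : a ^ 2 ≤ 1 := (sq_le_one_iff_abs_le_one a).2 (by simpa [ha] using h1)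
    have h4 : c ^ 2 ≤ 2 ^ 2 := sq_le_sq' (abs_le.1 h2).1 (abs_le.1 h2).2
    linarith
  have hc0 : 0 < c := by
    rw [hc, Int.cast_natCast]
    positivity
  have hn0 : 0 < a ^ 2 + c ^ 2 := by positivity
  set b := s * (-k : ℤ) + s ^ 3 * m with hb
  set d := s⁻¹ * m with hd
  set j := round ((a * b + c * d) / (a ^ 2 + c ^ 2)) with hj
  have hround := abs_sub_round ((a * b + c * d) / (a ^ 2 + c ^ 2))
  rw [← hj] at hround
  refine ⟨r.num, -k - j * r.num, r.den, m - j * r.den, by linear_combination hmk, hn1, ?_⟩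
  have hdet : a * d - b * c = 1 := by
    have : (m : ℝ) * r.num + k * (r.den : ℤ) = 1 := by exact_mod_cast hmk
    rw [ha, hb, hc, hd]
    push_cast at this ⊢
    field_simp
    linear_combination this
  have hb' : s * ((-k - j * r.num : ℤ) : ℝ) + s ^ 3 * ((m - j * r.den : ℤ) : ℝ) = b - j * a := by
    rw [ha, hb]
    push_cast
    ring
  have hd' : s⁻¹ * ((m - j * r.den : ℤ) : ℝ) = d - j * c := by
    rw [hc, hd]
    push_cast
    ring
  rw [hb', hd']
  have hkey : (a ^ 2 + c ^ 2) * ((b - j * a) ^ 2 + (d - j * c) ^ 2) =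
      1 + ((a ^ 2 + c ^ 2) * ((a * b + c * d) / (a ^ 2 + c ^ 2) - j)) ^ 2 := by
    field_simp
    linear_combination (a * d - b * c + 1) * hdet
  rw [hkey]
  have h3 : |(a ^ 2 + c ^ 2) * ((a * b + c * d) / (a ^ 2 + c ^ 2) - j)| ≤ 5 * (1 / 2) := by
    rw [abs_mul, abs_of_pos hn0]
    gcongr
  have := sq_le_sq' (abs_le.1 h3).1 (abs_le.1 h3).2
  linarith

theorem abs_le_of_eq_quarticSubst {h : Fin 5 → ℝ} {G : Fin 5 → ℤ} {K a b c d : ℝ} (hK : 1 ≤ K)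
    (hh : ∀ i, |h i| ≤ K) (hG : ∀ i, (G i : ℝ) = quarticSubst h a b c d i)
    (hΔ : quarticDiscr (G 0) (G 1) (G 2) (G 3) (G 4) ≠ 0) (hn : a ^ 2 + c ^ 2 ≤ 5)
    (hnn : (a ^ 2 + c ^ 2) * (b ^ 2 + d ^ 2) ≤ 9) (i : Fin 5) :
    |(G i : ℝ)| ≤ 30 * K * (540 * K) ^ 4 := by
  obtain ⟨r, hr⟩ : ∃ r, r = √(a ^ 2 + c ^ 2) := ⟨_, rfl⟩
  obtain ⟨r', hr'⟩ : ∃ r', r' = √(b ^ 2 + d ^ 2) := ⟨_, rfl⟩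
  have hr0 : 0 ≤ r := hr ▸ Real.sqrt_nonneg _
  have hr'0 : 0 ≤ r' := hr' ▸ Real.sqrt_nonneg _
  have hrsq : r ^ 2 = a ^ 2 + c ^ 2 := by rw [hr, Real.sq_sqrt (by positivity)]
  have hr'sq : r' ^ 2 = b ^ 2 + d ^ 2 := by rw [hr', Real.sq_sqrt (by positivity)]
  have ha : |a| ≤ r := hr ▸ Real.abs_le_sqrt (by nlinarith)
  have hc : |c| ≤ r := hr ▸ Real.abs_le_sqrt (by nlinarith)
  have hb : |b| ≤ r' := hr' ▸ Real.abs_le_sqrt (by nlinarith)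
  have hd : |d| ≤ r' := hr' ▸ Real.abs_le_sqrt (by nlinarith)
  rw [← hrsq] at hn
  rw [← hrsq, ← hr'sq] at hnn
  have hrr' : r * r' ≤ 3 := by
    refine le_of_sq_le_sq ?_ (by norm_num)
    nlinarith
  have hr3 : r ≤ 3 := by nlinarith
  have hbd := abs_quarticSubst_le hh ha hc hb hd
  have hlow : 1 ≤ r ^ 2 * (60 * K) := by
    by_contra! hlt
    refine hΔ ?_
    have h0 : G 0 = 0 := by
      refine Int.abs_lt_one_iff.1 ?_
      have := hbd 0
      rw [← hG 0] at this
      simp at this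
      have h2 : 5 * K * r ^ 4 < 1 := by nlinarith
      exact_mod_cast this.trans_lt h2
    have h1 : G 1 = 0 := by
      refine Int.abs_lt_one_iff.1 ?_
      have := hbd 1
      rw [← hG 1] at this
      simp at this
      have h2 : 5 * 4 * K * r ^ 3 * r' < 1 := by
        nlinarith [mul_le_mul_of_nonneg_left hrr' (by positivity : 0 ≤ 20 * K * r ^ 2)]
      exact_mod_cast this.trans_lt h2
    rw [h0, h1, quarticDiscr]
    ring
  have hr'1 : r' ≤ 540 * K := by
    have h1 : r' ^ 2 ≤ 540 * K := by
      nlinarith [mul_le_mul_of_nonneg_left hlow (sq_nonneg r')]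
    nlinarith
  have hr1 : r ≤ 540 * K := by linarith
  rw [hG i]
  refine (hbd i).trans ?_
  have hi : (i : ℕ) ≤ 4 := by omega
  have hchoose : ((Nat.choose 4 i : ℕ) : ℝ) ≤ 6 := by
    have : Nat.choose 4 i ≤ 6 := by fin_cases i <;> decide
    exact_mod_cast this
  calc 5 * (Nat.choose 4 i : ℝ) * K * r ^ (4 - i : ℕ) * r' ^ (i : ℕ)
      ≤ 5 * 6 * K * (540 * K) ^ (4 - i : ℕ) * (540 * K) ^ (i : ℕ) := by gcongr
    _ = 30 * K * (540 * K) ^ 4 := by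
      rw [mul_assoc _ (_ ^ _) (_ ^ _), ← pow_add, Nat.sub_add_cancel hi]
      norm_num

/-- The quartic forms attached to the integral points in the first quadrant have `SL₂(ℤ)`-equivalent
forms with coefficients bounded in terms of the curve. -/
theorem exists_quarticSubst_mordellQuartic_le {A B : ℤ} (hΔ : -4 * A ^ 3 - 27 * B ^ 2 ≠ 0) :
    ∃ N : ℤ, ∀ x y : ℤ, 1 ≤ x → 0 ≤ y → y ^ 2 = x ^ 3 + A * x + B →
      ∃ p p' q q' : ℤ, p * q' - p' * q = 1 ∧
        ∀ i, |quarticSubst (mordellQuartic A x y) p p' q q' i| ≤ N := by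
  set K : ℝ := 4 + 8 * (|(A : ℝ)| + |(B : ℝ)|) +
    4 * (2 * |(B : ℝ)| + |(A : ℝ)| * (|(A : ℝ)| + |(B : ℝ)|)) with hKdef
  have hK : 1 ≤ K := by
    have : 0 ≤ 8 * (|(A : ℝ)| + |(B : ℝ)|) +
      4 * (2 * |(B : ℝ)| + |(A : ℝ)| * (|(A : ℝ)| + |(B : ℝ)|)) := by positivity
    linarith
  refine ⟨⌊30 * K * (540 * K) ^ 4⌋, fun x y hx hy h => ?_⟩
  have hx' : (1 : ℝ) ≤ x := by exact_mod_cast hx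
  obtain ⟨s, hs, hsx⟩ : ∃ s : ℝ, 1 ≤ s ∧ s ^ 4 = x := by
    refine ⟨√(√x), Real.one_le_sqrt.2 (Real.one_le_sqrt.2 hx'), ?_⟩
    rw [show 4 = 2 * 2 by rfl, pow_mul, Real.sq_sqrt (Real.sqrt_nonneg _),
      Real.sq_sqrt (by linarith)]
  have hs0 : s ≠ 0 := by positivity
  obtain ⟨p, p', q, q', hdet, hn, hnn⟩ := exists_reduced_basis hs
  refine ⟨p, p', q, q', hdet, fun i => Int.le_floor.2 ?_⟩
  have hG : ∀ i, ((quarticSubst (mordellQuartic A x y) p p' q q' i : ℤ) : ℝ) =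
      quarticSubst (quarticSubst (mordellQuartic (A : ℝ) x y) s⁻¹ (-s ^ 3) 0 s)
        (s * p + s ^ 3 * q) (s * p' + s ^ 3 * q') (s⁻¹ * q) (s⁻¹ * q') i := by
    intro i
    have hg : (fun j => ((mordellQuartic A x y j : ℤ) : ℝ)) = mordellQuartic (A : ℝ) x y := by
      ext j
      fin_cases j <;> simp [mordellQuartic]
    rw [quarticSubst_quarticSubst, intCast_quarticSubst, hg]
    congr 1 <;> field_simp <;> ring
  have hΔ' : 110592 * (-4 * A ^ 3 - 27 * B ^ 2) ≠ 0 := mul_ne_zero (by norm_num) hΔ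
  rw [← quarticDiscr_mordellQuartic h, ← quarticDiscr_quarticSubst _ hdet] at hΔ'
  rw [Int.cast_abs]
  exact abs_le_of_eq_quarticSubst hK
    (abs_quarticSubst_mordellQuartic_le hs hsx (by exact_mod_cast hy) (by exact_mod_cast h))
    hG hΔ' hn hnn i

theorem finite_mordell_of_one_le_of_nonneg {A B : ℤ} (hΔ : -4 * A ^ 3 - 27 * B ^ 2 ≠ 0) :
    {P : ℤ × ℤ | 1 ≤ P.1 ∧ 0 ≤ P.2 ∧ P.2 ^ 2 = P.1 ^ 3 + A * P.1 + B}.Finite := by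
  obtain ⟨N, hN⟩ := exists_quarticSubst_mordellQuartic_le hΔ
  let forms : Set (Fin 5 → ℤ) := {G | G ∈ Set.Icc (fun _ => -N) (fun _ => N) ∧
    quarticDiscr (G 0) (G 1) (G 2) (G 3) (G 4) ≠ 0}
  have hforms : forms.Finite := (Set.finite_Icc _ _).subset fun G hG => hG.1
  let point (G : Fin 5 → ℤ) (w : ℤ × ℤ) : ℤ × ℤ :=
    let p := (4 * G 0 * w.1 ^ 3 + 3 * G 1 * w.1 ^ 2 * w.2 + 2 * G 2 * w.1 * w.2 ^ 2 +
      G 3 * w.2 ^ 3) / 4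
    let p' := (G 1 * w.1 ^ 3 + 2 * G 2 * w.1 ^ 2 * w.2 + 3 * G 3 * w.1 * w.2 ^ 2 +
      4 * G 4 * w.2 ^ 3) / 4
    (quarticSubst G w.1 (-p') w.2 p 2 / -6, quarticSubst G w.1 (-p') w.2 p 3 / -8)
  refine (hforms.biUnion fun G hG =>
    (finite_quarticForm_eq_one hG.2).image (point G)).subset ?_
  rintro ⟨x, y⟩ ⟨hx, hy, h⟩
  obtain ⟨p, p', q, q', hdet, hle⟩ := hN x y hx hy h
  have hΔ' : 110592 * (-4 * A ^ 3 - 27 * B ^ 2) ≠ 0 := mul_ne_zero (by norm_num) hΔ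
  rw [← quarticDiscr_mordellQuartic h, ← quarticDiscr_quarticSubst _ hdet] at hΔ'
  refine Set.mem_biUnion (x := quarticSubst (mordellQuartic A x y) p p' q q')
    ⟨⟨fun i => (abs_le.1 (hle i)).1, fun i => (abs_le.1 (hle i)).2⟩, hΔ'⟩ ⟨(q', -q), ?_, ?_⟩
  · have h1 : p * q' + p' * -q = 1 := by linear_combination hdet
    have h2 : q * q' + q' * -q = 0 := by ring
    rw [Set.mem_ofPred_eq, quarticForm_quarticSubst, h1, h2]
    simp [quarticForm, mordellQuartic]
  · set G := quarticSubst (mordellQuartic A x y) p p' q q' with hGdef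
    have hp : 4 * G 0 * q' ^ 3 + 3 * G 1 * q' ^ 2 * (-q) + 2 * G 2 * q' * (-q) ^ 2 +
        G 3 * (-q) ^ 3 = 4 * p := by
      have : 4 * G 0 * q' ^ 3 + 3 * G 1 * q' ^ 2 * (-q) + 2 * G 2 * q' * (-q) ^ 2 +
          G 3 * (-q) ^ 3 = 4 * p * (p * q' - p' * q) ^ 3 := by
        simp [hGdef, quarticSubst, mordellQuartic]
        ring
      rw [this, hdet]
      ring
    have hp' : G 1 * q' ^ 3 + 2 * G 2 * q' ^ 2 * (-q) + 3 * G 3 * q' * (-q) ^ 2 +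
        4 * G 4 * (-q) ^ 3 = 4 * p' := by
      have : G 1 * q' ^ 3 + 2 * G 2 * q' ^ 2 * (-q) + 3 * G 3 * q' * (-q) ^ 2 +
          4 * G 4 * (-q) ^ 3 = 4 * p' * (p * q' - p' * q) ^ 3 := by
        simp [hGdef, quarticSubst, mordellQuartic]
        ring
      rw [this, hdet]
      ring
    have hinv : quarticSubst G q' (-p') (-q) p = mordellQuartic A x y := by
      rw [hGdef, quarticSubst_quarticSubst, show p * q' + p' * -q = 1 by linear_combination hdet,
        show p * -p' + p' * p = 0 by ring, show q * q' + q' * -q = 0 by ring,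
        show q * -p' + q' * p = 1 by linear_combination hdet, quarticSubst_one]
    simp only [point]
    rw [hp, hp', Int.mul_ediv_cancel_left _ (by norm_num), Int.mul_ediv_cancel_left _ (by norm_num),
      hinv]
    simp only [mordellQuartic, Matrix.cons_val]
    rw [Int.mul_ediv_cancel_left _ (by norm_num), Int.mul_ediv_cancel_left _ (by norm_num)]

/-- An elliptic curve `y² = x³ + A x + B` over `ℤ` has finitely many integral points. -/
theorem finite_mordell {A B : ℤ} (hΔ : -4 * A ^ 3 - 27 * B ^ 2 ≠ 0) :
    {P : ℤ × ℤ | P.2 ^ 2 = P.1 ^ 3 + A * P.1 + B}.Finite := by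
  have hfin := finite_mordell_of_one_le_of_nonneg hΔ
  set N := |A| + |B| + 1
  have hA := abs_nonneg A
  have hB := abs_nonneg B
  refine ((hfin.union (hfin.image fun P => (P.1, -P.2))).union
    ((Set.finite_Icc (-N) 0).prod (Set.finite_Icc (-(|A| * N + |B|)) (|A| * N + |B|)))).subset ?_
  rintro ⟨x, y⟩ h
  simp only [Set.mem_ofPred_eq] at h
  rcases lt_or_ge 0 x with hx | hx
  · left
    rcases le_total 0 y with hy | hy
    · exact .inl ⟨hx, hy, h⟩
    · exact .inr ⟨(x, -y), ⟨hx, by simpa using hy, by simpa using h⟩, by simp⟩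
  · right
    have hAx : A * x ≤ |A| * -x := by
      rw [← abs_of_nonpos hx, ← abs_mul]
      exact le_abs_self _
    have hxN : -N ≤ x := by
      by_contra! hlt
      have h1 : N * -x < x ^ 2 := by nlinarith
      nlinarith [le_abs_self B, sq_nonneg y]
    have hy2 : y ^ 2 ≤ |A| * N + |B| := by
      have h1 : x ^ 3 ≤ 0 := Odd.pow_nonpos (by decide) hx
      nlinarith [le_abs_self B]
    have hy : |y| ≤ y ^ 2 := by
      rw [← sq_abs]
      exact Int.le_self_sq _
    exact ⟨⟨hxN, hx⟩, abs_le.1 (hy.trans hy2)⟩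

end

/-- Siegel's theorem for the quadratic twist `E_d : y² = x³ + d²a·x + d³b`: if `d ≠ 0` and the
cubic `x³ + d²a·x + d³b` has nonzero discriminant, then the curve has only finitely many
integral points. -/
theorem stmt_4 (a b d : ℤ) (hd : d ≠ 0)
    (hdisc : -4 * (d ^ 2 * a) ^ 3 - 27 * (d ^ 3 * b) ^ 2 ≠ 0) :
    {P : ℤ × ℤ | P.2 ^ 2 = P.1 ^ 3 + d ^ 2 * a * P.1 + d ^ 3 * b}.Finite := by
  exact finite_mordell hdisc
end

section
/- The torsion subgroup of the group of rational points of the elliptic curve E₋₃ : y² = x³ − 432 over ℚ is isomorphic to ℤ/3ℤ; that is, the subgroup of points of E₋₃(ℚ) of finite order is a cyclic group of order 3. -/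
/-- The elliptic curve `E₋₃ : y² = x³ − 432` over `ℚ`, the quadratic twist of
`y² = x³ + 16` by `−3`. -/
noncomputable def Eneg3 : WeierstrassCurve.Affine ℚ :=
  { a₁ := 0, a₂ := 0, a₃ := 0, a₄ := 0, a₆ := -432 }

namespace Eneg3

theorem nonsingular_iff (x y : ℚ) :
    Eneg3.Nonsingular x y ↔ x = 12 ∧ (y = 36 ∨ y = -36) := by
  simp only [WeierstrassCurve.Affine.nonsingular_iff, WeierstrassCurve.Affine.equation_iff, Eneg3]
  constructor
  · rintro ⟨h, -⟩
    have hx : x ≠ 0 := by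
      rintro rfl
      nlinarith [sq_nonneg y]
    have fermat := fermatLastTheoremFor_iff_rat.mp fermatLastTheoremThree
    have hy : (y - 36) * (y + 36) = 0 := by
      by_contra hne
      obtain ⟨h₁, h₂⟩ := mul_ne_zero_iff.mp hne
      refine fermat (36 + y) (36 - y) (6 * x) ?_ ?_ (by simpa using hx) (by linear_combination 216 * h)
      · rwa [add_comm]
      · rwa [← neg_sub, neg_ne_zero]
    refine ⟨?_, (mul_eq_zero.mp hy).imp (by intro h; linarith) (by intro h; linarith)⟩
    have : (x - 12) * (x ^ 2 + 12 * x + 144) = 0 := by linear_combination hy - h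
    rcases mul_eq_zero.mp this with h | h
    · linarith
    · nlinarith [sq_nonneg (x + 6)]
  · rintro ⟨rfl, rfl | rfl⟩ <;> norm_num

theorem card_point : Nat.card Eneg3.Point = 3 := by
  let P : Eneg3.Point := .some 12 36 ((nonsingular_iff _ _).mpr (by simp))
  let Q : Eneg3.Point := .some 12 (-36) ((nonsingular_iff _ _).mpr (by simp))
  have huniv : (Set.univ : Set Eneg3.Point) = {0, P, Q} := by
    ext R
    rcases R with _ | ⟨x, y, h⟩
    · exact iff_of_true trivial (Or.inl rfl)
    · obtain ⟨rfl, rfl | rfl⟩ := (nonsingular_iff x y).mp h <;> simp [P, Q]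
  have hPQ : P ≠ Q := by
    simp only [P, Q, ne_eq, WeierstrassCurve.Affine.Point.some.injEq]
    norm_num
  rw [← Set.ncard_univ, huniv]
  refine Set.ncard_eq_three.mpr ⟨0, P, Q, ?_, ?_, hPQ, rfl⟩ <;> exact nofun

end Eneg3

/-- The torsion subgroup of the group of rational points of `E₋₃ : y² = x³ − 432` over `ℚ`
is isomorphic to `ℤ/3ℤ`. -/
theorem stmt_6 : Nonempty ((AddCommGroup.torsion Eneg3.Point) ≃+ ZMod 3) := by
  have : Finite Eneg3.Point := Nat.finite_of_card_ne_zero (by simp [Eneg3.card_point])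
  have htop : AddCommGroup.torsion Eneg3.Point = ⊤ :=
    eq_top_iff.mpr fun P _ ↦ isOfFinAddOrder_of_finite P
  rw [htop]
  have : Fact (Nat.Prime 3) := ⟨Nat.prime_three⟩
  exact ⟨AddSubgroup.topEquiv.trans
    (addEquivOfPrimeCardEq (p := 3) Eneg3.card_point (Nat.card_zmod 3))⟩
end

section
/- There are infinitely many primes p such that −p³ − 432 is not a perfect square and the ideal class group of the imaginary biquadratic field ℚ(√−3, √(−p³ − 432)) contains a nontrivial element whose order is 3 or 6. -/
open NumberField

/-- Galois descent for ideals along an unramified cyclic cubic extension of rings. -/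
theorem Ideal.map_comap_eq_of_cubic_stable {A B : Type*} [CommRing A] [CommRing B] [Algebra A B]
    (s : B →ₐ[A] B) (hs : ∀ b, s (s (s b)) = b)
    (hfix : ∀ b, s b = b → ∃ a, algebraMap A B a = b) (r : B)
    (hr : ∃ u v t : B, u * ((r - s r) * (r - s (s r))) + v * ((s r - s (s r)) * (s r - r)) +
      t * ((s (s r) - r) * (s (s r) - s r)) = 1)
    (I : Ideal B) (hI : ∀ b ∈ I, s b ∈ I) :
    (I.comap (algebraMap A B)).map (algebraMap A B) = I := by
  apply le_antisymm Ideal.map_comap_le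
  set J := (I.comap (algebraMap A B)).map (algebraMap A B) with hJ
  have htr : ∀ b ∈ I, b + s b + s (s b) ∈ J := by
    intro b hb
    obtain ⟨a, ha⟩ := hfix (b + s b + s (s b)) (by simp only [map_add, hs]; ring)
    rw [← ha]
    apply Ideal.mem_map_of_mem
    rw [Ideal.mem_comap, ha]
    exact I.add_mem (I.add_mem hb (hI _ hb)) (hI _ (hI _ hb))
  have hsJ : ∀ b ∈ J, s b ∈ J := by
    have : J ≤ J.comap s := by
      rw [hJ, Ideal.map_le_iff_le_comap]
      intro a ha
      simpa using Ideal.mem_map_of_mem (algebraMap A B) ha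
    exact fun b hb ↦ this hb
  have hd : ∀ b ∈ I, (r - s r) * (r - s (s r)) * b ∈ J := by
    intro b hb
    have h0 := htr b hb
    have h1 := htr (r * b) (I.mul_mem_left _ hb)
    have h2 := htr (r ^ 2 * b) (I.mul_mem_left _ hb)
    simp only [map_mul, map_pow] at h1 h2
    convert J.add_mem (J.sub_mem h2 (J.mul_mem_left (s r + s (s r)) h1))
      (J.mul_mem_left (s r * s (s r)) h0) using 1
    ring
  intro b hb
  obtain ⟨u, v, t, h⟩ := hr
  have e1 := hd b hb
  have e2 := hsJ _ (hd _ (hI _ (hI _ hb)))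
  have e3 := hsJ _ (hsJ _ (hd _ (hI _ hb)))
  simp only [map_mul, map_sub, hs] at e2 e3
  convert J.add_mem (J.add_mem (J.mul_mem_left u e1) (J.mul_mem_left v e2))
    (J.mul_mem_left t e3) using 1
  linear_combination (-b) * h

/-- A form of Hilbert's Theorem 90 for a ring endomorphism `s` moving an element `r`. -/
theorem exists_ne_zero_eq_mul_of_cubic_norm_eq_one {B : Type*} [CommRing B] (s : B →+* B)
    (hs : ∀ b, s (s (s b)) = b) (r : B) (hr : (r - s r) * (r - s (s r)) ≠ 0) (x : B)
    (hx : x * s x * s (s x) = 1) : ∃ y ≠ 0, y = x * s y := by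
  have key : ∀ c, c + x * s c + x * s x * s (s c) =
      x * s (c + x * s c + x * s x * s (s c)) := by
    intro c
    simp only [map_add, map_mul, hs]
    linear_combination (-c) * hx
  by_contra! H
  have h : ∀ c, c + x * s c + x * s x * s (s c) = 0 := fun c ↦ by
    by_contra hc
    exact H _ hc (key c)
  apply hr
  have h0 := h 1
  have h1 := h r
  have h2 := h (r ^ 2)
  simp only [map_one, map_pow] at h0 h2
  linear_combination h2 - (s r + s (s r)) * h1 + s r * s (s r) * h0

/-- If every unit of relative norm one is `u / s u`, then every unit is a cube. -/
theorem Units.exists_eq_cube_of_cubic {E : Type*} [CommGroup E] (s : E →* E)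
    (hs : ∀ b, s (s (s b)) = b) (n : ℕ) (hn : n.Coprime 3)
    (hN : ∀ x : E, (x * s x * s (s x)) ^ n = 1)
    (h90 : ∀ x : E, x * s x * s (s x) = 1 → ∃ y, y = x * s y) (x : E) : ∃ y, x = y ^ 3 := by
  have step : ∀ x : E, ∃ y, x ^ n = y * (s y)⁻¹ := by
    intro x
    obtain ⟨y, hy⟩ := h90 (x ^ n) (by simpa only [map_pow, mul_pow] using hN x)
    exact ⟨y, eq_mul_inv_of_mul_eq hy.symm⟩
  obtain ⟨a, ha⟩ := step x
  obtain ⟨b, hb⟩ := step a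
  obtain ⟨c, hc⟩ := step b
  have h2 : a ^ (n * n) = c * (s c)⁻¹ * (s (c * (s c)⁻¹))⁻¹ := by
    rw [pow_mul, hb, mul_pow, inv_pow, ← map_pow, hc]
  have h3 : x ^ (n * n * n) = (s (s c) * (s c)⁻¹) ^ 3 := by
    rw [mul_comm, pow_mul, ha, mul_pow, inv_pow, ← map_pow, h2]
    simp only [map_mul, map_inv, hs, pow_succ, pow_zero, one_mul]
    apply Additive.ofMul.injective
    simp only [ofMul_mul, ofMul_inv]
    abel
  have hco : (n * n * n).Coprime 3 := (hn.mul_left hn).mul_left hn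
  generalize n * n * n = m at h3 hco
  generalize s (s c) * (s c)⁻¹ = w at h3
  have hz : (m : ℤ) * Nat.gcdA m 3 + (3 : ℕ) * Nat.gcdB m 3 = 1 := by
    rw [← Nat.gcd_eq_gcd_ab, hco.gcd_eq_one, Nat.cast_one]
  refine ⟨w ^ Nat.gcdA m 3 * x ^ Nat.gcdB m 3, ?_⟩
  calc x = x ^ ((m : ℤ) * Nat.gcdA m 3 + (3 : ℕ) * Nat.gcdB m 3) := by rw [hz, zpow_one]
    _ = (w ^ 3) ^ Nat.gcdA m 3 * (x ^ Nat.gcdB m 3) ^ 3 := by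
      rw [zpow_add, zpow_mul, zpow_natCast, h3, mul_comm ((3 : ℕ) : ℤ), zpow_mul, zpow_natCast]
    _ = (w ^ Nat.gcdA m 3 * x ^ Nat.gcdB m 3) ^ 3 := by
      rw [mul_pow, ← zpow_natCast w, ← zpow_natCast (w ^ _), zpow_comm]

theorem Module.Basis.ne_three_nsmul {ι M : Type*} [AddCommGroup M] (b : Module.Basis ι ℤ M)
    (i : ι) (v : M) : b i ≠ 3 • v := by
  intro h
  have h2 := congrArg (fun v ↦ b.repr v i) h
  simp at h2
  omega

theorem NumberField.Units.exists_not_cube {L : Type*} [Field L] [NumberField L]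
    (h : 0 < NumberField.Units.rank L) : ∃ x : (𝓞 L)ˣ, ¬ ∃ y, x = y ^ 3 := by
  refine ⟨NumberField.Units.fundSystem L ⟨0, h⟩, fun ⟨y, hy⟩ ↦ ?_⟩
  have h1 := NumberField.Units.fundSystem_mk (K := L) ⟨0, h⟩
  refine Module.Basis.ne_three_nsmul (M := Additive ((𝓞 L)ˣ ⧸ NumberField.Units.torsion L))
    (NumberField.Units.basisModTorsion L) ⟨0, h⟩ (Additive.ofMul (QuotientGroup.mk y)) ?_
  rw [← h1, hy]
  rfl

/-- A form of Hilbert's Theorem 94 for a cubic extension `L / k` such that all units of `k` have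
order prime to `3`: some non-principal ideal of `k` has principal cube. -/
theorem NumberField.exists_not_isPrincipal_of_cubic (k L : Type*) [Field k] [Field L]
    [NumberField k] [NumberField L] [Algebra k L] (hkL : Module.finrank k L = 3)
    (hL : 0 < NumberField.Units.rank L) (n : ℕ) (hn : n.Coprime 3) (hk : ∀ u : (𝓞 k)ˣ, u ^ n = 1)
    (s : 𝓞 L →ₐ[𝓞 k] 𝓞 L) (hs : ∀ b, s (s (s b)) = b)
    (hfix : ∀ b, s b = b → ∃ a, algebraMap (𝓞 k) (𝓞 L) a = b) (r : 𝓞 L)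
    (hr0 : (r - s r) * (r - s (s r)) ≠ 0)
    (hr : ∃ u v t : 𝓞 L, u * ((r - s r) * (r - s (s r))) + v * ((s r - s (s r)) * (s r - r)) +
      t * ((s (s r) - r) * (s (s r) - s r)) = 1) :
    ∃ I : Ideal (𝓞 k), ¬ I.IsPrincipal ∧ (I ^ 3).IsPrincipal := by
  by_contra! H
  obtain ⟨x, hx⟩ := NumberField.Units.exists_not_cube hL
  have hinj : Function.Injective (algebraMap (𝓞 k) (𝓞 L)) := FaithfulSMul.algebraMap_injective _ _
  have hfr : Module.finrank (𝓞 k) (𝓞 L) = 3 := by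
    rw [← hkL, IsFractionRing.finrank_eq (𝓞 k) k (𝓞 L) L]
  refine hx (Units.exists_eq_cube_of_cubic (Units.map (s : 𝓞 L →* 𝓞 L)) (fun b ↦ ?_) n hn
    (fun u ↦ ?_) (fun u hu ↦ ?_) x)
  · ext1
    simp [hs]
  · have hfixu : ∀ u : (𝓞 L)ˣ, ∃ a, algebraMap (𝓞 k) (𝓞 L) a = u * s u * s (s u) := fun u ↦
      hfix _ (by simp only [map_mul, hs]; ring)
    obtain ⟨a, ha⟩ := hfixu u
    obtain ⟨b, hb⟩ := hfixu u⁻¹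
    have hab : a * b = 1 := by
      apply hinj
      have h1 : (u : 𝓞 L) * (u⁻¹ : (𝓞 L)ˣ) = 1 := by simp
      have h2 := congrArg s h1
      have h3 := congrArg s h2
      simp only [map_mul, map_one] at h2 h3
      rw [map_mul, ha, hb, map_one]
      calc _ = ((u : 𝓞 L) * (u⁻¹ : (𝓞 L)ˣ)) * (s u * s (u⁻¹ : (𝓞 L)ˣ)) *
            (s (s u) * s (s (u⁻¹ : (𝓞 L)ˣ))) := by ring
        _ = 1 := by rw [h1, h2, h3]; ring
    have h := congrArg Units.val (hk (Units.mkOfMulEqOne a b hab))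
    ext1
    simp only [Units.val_pow_eq_pow_val, Units.val_mkOfMulEqOne, Units.val_one] at h
    simp only [Units.val_pow_eq_pow_val, Units.val_mul, Units.coe_map, Units.val_one]
    have := congrArg (algebraMap (𝓞 k) (𝓞 L)) h
    rwa [map_pow, ha, map_one] at this
  · have hu' : (u : 𝓞 L) * s u * s (s u) = 1 := by simpa using congrArg Units.val hu
    obtain ⟨y, hy0, hy⟩ := exists_ne_zero_eq_mul_of_cubic_norm_eq_one (s : 𝓞 L →+* 𝓞 L) hs r hr0
      (u : 𝓞 L) hu'
    rw [RingHom.coe_coe] at hy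
    have hsy : s y = (u⁻¹ : (𝓞 L)ˣ) * y := by
      rw [hy, ← mul_assoc, Units.inv_mul, one_mul, ← hy]
    have hI := Ideal.map_comap_eq_of_cubic_stable s hs hfix r hr (Ideal.span {y}) (fun b hb ↦ by
      obtain ⟨c, rfl⟩ := Ideal.mem_span_singleton'.mp hb
      rw [map_mul, hsy]
      exact Ideal.mem_span_singleton'.mpr ⟨s c * (u⁻¹ : (𝓞 L)ˣ), by ring⟩)
    set I := (Ideal.span {y}).comap (algebraMap (𝓞 k) (𝓞 L)) with hIdef
    have hI3 : (I ^ 3).IsPrincipal := by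
      rw [← hfr, ← Ideal.relNorm_algebraMap (𝓞 L) I, hI, Ideal.relNorm_singleton]
      exact ⟨_, rfl⟩
    obtain ⟨a, ha⟩ : I.IsPrincipal := by
      by_contra h
      exact H I h hI3
    rw [ha, Ideal.submodule_span_eq, Ideal.map_span, Set.image_singleton,
      Ideal.span_singleton_eq_span_singleton] at hI
    obtain ⟨v, hv⟩ := hI
    refine ⟨v, ?_⟩
    ext1
    have ha0 : algebraMap (𝓞 k) (𝓞 L) a ≠ 0 := fun h ↦ hy0 (by rw [← hv, h, zero_mul])
    apply mul_left_cancel₀ ha0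
    rw [hv, hy, ← hv, map_mul, s.commutes]
    simp only [Units.val_mul, Units.coe_map, MonoidHom.coe_coe]
    ring

/-- The extension of an ideal with principal cube to a field of relative degree prime to `3`. -/
theorem NumberField.exists_orderOf_eq_three (k K : Type*) [Field k] [Field K]
    [NumberField k] [NumberField K] [Algebra k K] (hkK : (Module.finrank k K).Coprime 3)
    (h : ∃ I : Ideal (𝓞 k), ¬ I.IsPrincipal ∧ (I ^ 3).IsPrincipal) :
    ∃ c : ClassGroup (𝓞 K), orderOf c = 3 := by
  obtain ⟨I, hI, hI3⟩ := h
  have hI0 : I ≠ ⊥ := fun h ↦ hI (h ▸ bot_isPrincipal)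
  have hfr : Module.finrank (𝓞 k) (𝓞 K) = Module.finrank k K := by
    rw [IsFractionRing.finrank_eq (𝓞 k) k (𝓞 K) K]
  have hinj : Function.Injective (algebraMap (𝓞 k) (𝓞 K)) := FaithfulSMul.algebraMap_injective _ _
  set J := I.map (algebraMap (𝓞 k) (𝓞 K)) with hJ
  have hJ0 : J ∈ nonZeroDivisors (Ideal (𝓞 K)) := mem_nonZeroDivisors_of_ne_zero
    (by rwa [hJ, Ideal.zero_eq_bot, Ne, Ideal.map_eq_bot_iff_of_injective hinj])
  have hI0' : I ∈ nonZeroDivisors (Ideal (𝓞 k)) := mem_nonZeroDivisors_of_ne_zero hI0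
  refine ⟨ClassGroup.mk0 ⟨J, hJ0⟩, orderOf_eq_prime ?_ ?_⟩
  · rw [← map_pow]
    refine (ClassGroup.mk0_eq_one_iff (pow_mem hJ0 3)).mpr ?_
    obtain ⟨a, ha⟩ := hI3
    rw [hJ, ← Ideal.map_pow, ha, Ideal.submodule_span_eq, Ideal.map_span, Set.image_singleton]
    exact ⟨_, rfl⟩
  · intro h
    obtain ⟨b, hb⟩ := (ClassGroup.mk0_eq_one_iff hJ0).mp h
    have hIn : (I ^ Module.finrank k K).IsPrincipal := by
      rw [← hfr, ← Ideal.relNorm_algebraMap (𝓞 K) I, ← hJ, hb, Ideal.submodule_span_eq,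
        Ideal.relNorm_singleton]
      exact ⟨_, rfl⟩
    have e1 := (ClassGroup.mk0_eq_one_iff (pow_mem hI0' 3)).mpr hI3
    have e2 := (ClassGroup.mk0_eq_one_iff (pow_mem hI0' (Module.finrank k K))).mpr hIn
    refine hI ((ClassGroup.mk0_eq_one_iff hI0').mp ?_)
    rw [← orderOf_eq_one_iff]
    refine Nat.eq_one_of_dvd_coprimes hkK (orderOf_dvd_of_pow_eq_one ?_)
      (orderOf_dvd_of_pow_eq_one ?_)
    · rw [← e2, ← map_pow]; rfl
    · rw [← e1, ← map_pow]; rfl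

theorem NumberField.isTotallyComplex_of_sq_eq {F : Type*} [Field F] {w : F} {m : ℤ}
    (hm : m < 0) (hw : w ^ 2 = m) : IsTotallyComplex F := by
  refine ⟨fun v ↦ InfinitePlace.not_isReal_iff_isComplex.mp fun hv ↦ ?_⟩
  have h := congrArg (InfinitePlace.embedding_of_isReal hv) hw
  rw [map_pow, map_intCast] at h
  have : (m : ℝ) < 0 := by exact_mod_cast hm
  nlinarith [sq_nonneg (InfinitePlace.embedding_of_isReal hv w)]

/-- In a totally complex field of degree at most two without `√-3`, all units have order prime
to three. -/
theorem NumberField.Units.exists_pow_eq_one_of_finrank_le_two (k : Type*) [Field k] [NumberField k]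
    [IsTotallyComplex k] (h2 : Module.finrank ℚ k ≤ 2) (h3 : ∀ s : k, s ^ 2 ≠ -3) :
    ∃ n : ℕ, n.Coprime 3 ∧ ∀ u : (𝓞 k)ˣ, u ^ n = 1 := by
  have hrank : NumberField.Units.rank k = 0 := by
    have h := IsTotallyComplex.finrank k
    have hc := InfinitePlace.card_eq_nrRealPlaces_add_nrComplexPlaces k
    rw [IsTotallyComplex.nrRealPlaces_eq_zero] at hc
    rw [NumberField.Units.rank, hc]
    omega
  refine ⟨Nat.card (NumberField.Units.torsion k), ?_, fun u ↦ ?_⟩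
  · rw [Nat.coprime_comm, Nat.Prime.coprime_iff_not_dvd Nat.prime_three]
    intro h
    obtain ⟨ζ, hζ⟩ := exists_prime_orderOf_dvd_card' 3 h
    have hp : ζ ^ 3 = 1 := hζ ▸ pow_orderOf_eq_one ζ
    have h1 : ζ ≠ 1 := by
      rintro rfl
      simp at hζ
    set x : k := (((ζ : (𝓞 k)ˣ) : 𝓞 k) : k) with hx
    have hx3 : x ^ 3 = 1 := by
      have := congrArg (fun z : NumberField.Units.torsion k ↦ (((z : (𝓞 k)ˣ) : 𝓞 k) : k)) hp
      simpa using this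
    have hx1 : x - 1 ≠ 0 := fun h ↦ h1 (by
      ext
      simpa [sub_eq_zero, hx] using h)
    apply h3 (2 * x + 1)
    apply mul_left_cancel₀ hx1
    linear_combination 4 * hx3
  · obtain ⟨⟨ζ, e⟩, hu, -⟩ := NumberField.Units.exist_unique_eq_mul_prod k u
    have : IsEmpty (Fin (NumberField.Units.rank k)) := by rw [hrank]; infer_instance
    simp only [Finset.univ_eq_empty, Finset.prod_empty, mul_one] at hu
    rw [hu]
    exact_mod_cast congrArg Subtype.val (pow_card_eq_one' (x := ζ))

theorem sq_ne_neg_three_of_finrank_le_two {k : Type*} [Field k] [NumberField k]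
    (h2 : Module.finrank ℚ k ≤ 2) {d : ℕ} (hd : 0 < d) (h3 : ¬ 3 ∣ d) {w : k} (hw : w ^ 2 = -d)
    (s : k) : s ^ 2 ≠ -3 := by
  intro hs
  have hdep : ¬ LinearIndependent ℚ ![1, w, s] := fun h ↦ by
    have := h.fintype_card_le_finrank
    simp at this
    omega
  obtain ⟨g, hg, i, hi⟩ := Fintype.not_linearIndependent_iff.mp hdep
  obtain ⟨a, b, c, hga⟩ : ∃ a b c : ℚ, g = ![a, b, c] :=
    ⟨g 0, g 1, g 2, by ext i; fin_cases i <;> rfl⟩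
  subst hga
  simp only [Fin.sum_univ_three, Matrix.cons_val_zero, Matrix.cons_val_one, Matrix.cons_val,
    Algebra.smul_def, mul_one, eq_ratCast] at hg
  have hdq : (0 : ℚ) < d := by exact_mod_cast hd
  have key : (-3 * c ^ 2 - a ^ 2 + d * b ^ 2 : ℚ) = 2 * a * b * w := by
    push_cast
    linear_combination (c * s - a - b * w) * hg - c ^ 2 * hs + b ^ 2 * hw
  have key2 : (-3 * c ^ 2 - a ^ 2 + d * b ^ 2) ^ 2 = - d * (2 * a * b) ^ 2 := by
    have : (((-3 * c ^ 2 - a ^ 2 + d * b ^ 2) ^ 2 : ℚ) : k) = ((- d * (2 * a * b) ^ 2 : ℚ) : k) := by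
      rw [Rat.cast_pow, key]
      push_cast
      linear_combination (2 * a * b) ^ 2 * hw
    exact_mod_cast this
  have hab : a * b = 0 := by
    have : (d : ℚ) * (a * b) ^ 2 ≤ 0 := by nlinarith [sq_nonneg (-3 * c ^ 2 - a ^ 2 + d * b ^ 2)]
    by_contra h
    have := mul_pos hdq (pow_pos (abs_pos.mpr h) 2)
    rw [sq_abs] at this
    linarith
  have key3 : -3 * c ^ 2 - a ^ 2 + d * b ^ 2 = 0 := by
    rw [mul_assoc 2 a b, hab] at key2
    simpa using key2
  have hb : b ≠ 0 := by
    rintro rfl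
    have ha : a = 0 := by nlinarith [sq_nonneg a, sq_nonneg c]
    have hc : c = 0 := by nlinarith [sq_nonneg a, sq_nonneg c]
    subst ha hc
    fin_cases i <;> simp at hi
  have ha : a = 0 := (mul_eq_zero.mp hab).resolve_right hb
  subst ha
  have hsq : IsSquare ((3 * d : ℕ) : ℚ) := ⟨3 * c / b, by
    field_simp
    push_cast
    linear_combination 3 * key3⟩
  rw [Rat.isSquare_natCast_iff] at hsq
  obtain ⟨m, hm⟩ := hsq
  have h3m : 3 ∣ m := by
    have : 3 ∣ m * m := ⟨d, hm.symm⟩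
    exact (Nat.Prime.dvd_mul Nat.prime_three).mp this |>.elim id id
  obtain ⟨m', rfl⟩ := h3m
  exact h3 ⟨m' * m', by linarith⟩

open Polynomial in
theorem irreducible_cubic_of_finrank_le_two {k : Type*} [Field k] [NumberField k]
    (h2 : Module.finrank ℚ k ≤ 2) {p : ℕ} (hp : 7 < p) :
    Irreducible (X ^ 3 + C (p : k) * X + C 8 : k[X]) := by
  have hint : ∀ x : ℤ, x ^ 3 + p * x + 8 ≠ 0 := by
    intro x hx
    have hp' : (7 : ℤ) < p := by exact_mod_cast hp
    have hneg : x < 0 := by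
      by_contra! h
      nlinarith [pow_nonneg h 3, mul_nonneg (by linarith : (0 : ℤ) ≤ p) h]
    have : x ≤ -1 := by omega
    nlinarith [sq_nonneg x]
  have hirr : Irreducible (X ^ 3 + C (p : ℚ) * X + C 8 : ℚ[X]) := by
    have hdeg : (X ^ 3 + C (p : ℚ) * X + C 8 : ℚ[X]).natDegree = 3 := by compute_degree!
    rw [irreducible_iff_roots_eq_zero_of_degree_le_three (by rw [hdeg]; norm_num) hdeg.le,
      Multiset.eq_zero_iff_forall_notMem]
    intro x hx
    have hx' : x ^ 3 + p * x + 8 = 0 := by simpa using isRoot_of_mem_roots hx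
    have hxi : IsIntegral ℤ x := by
      refine ⟨X ^ 3 + C (p : ℤ) * X + C 8, by monicity!, by simpa using hx'⟩
    obtain ⟨y, rfl⟩ := IsIntegrallyClosed.isIntegral_iff.mp hxi
    rw [eq_intCast] at hx'
    exact hint y (by exact_mod_cast hx')
  have hdeg : (X ^ 3 + C (p : k) * X + C 8 : k[X]).natDegree = 3 := by compute_degree!
  rw [irreducible_iff_roots_eq_zero_of_degree_le_three (by rw [hdeg]; norm_num) hdeg.le,
    Multiset.eq_zero_iff_forall_notMem]
  intro x hx
  have hx' : x ^ 3 + p * x + 8 = 0 := by simpa using isRoot_of_mem_roots hx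
  have hmin : X ^ 3 + C (p : ℚ) * X + C 8 = minpoly ℚ x :=
    minpoly.eq_of_irreducible_of_monic hirr (by simpa using hx') (by monicity!)
  have h := minpoly.natDegree_le (A := ℚ) x
  rw [← hmin] at h
  have : (X ^ 3 + C (p : ℚ) * X + C 8 : ℚ[X]).natDegree = 3 := by compute_degree!
  omega

theorem NumberField.mem_range_algebraMap_of_fixed {k L : Type*} [Field k] [Field L]
    [NumberField k] [NumberField L] [Algebra k L] (hkL : (Module.finrank k L).Prime)
    (s : L →ₐ[k] L) (r : L) (hr : s r ≠ r) (b : 𝓞 L) (hb : s b = b) :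
    ∃ a, algebraMap (𝓞 k) (𝓞 L) a = b := by
  have := Subalgebra.isSimpleOrder_of_finrank_prime k L hkL
  have hbot : AlgHom.equalizer s (AlgHom.id k L) = ⊥ := by
    refine (IsSimpleOrder.eq_bot_or_eq_top _).resolve_right fun h ↦ hr ?_
    have : r ∈ AlgHom.equalizer s (AlgHom.id k L) := h ▸ Algebra.mem_top
    simpa using this
  have hmem : (b : L) ∈ AlgHom.equalizer s (AlgHom.id k L) := by simpa using hb
  rw [hbot, Algebra.mem_bot] at hmem
  obtain ⟨a, ha⟩ := hmem
  have hint : IsIntegral ℤ a := by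
    rw [← isIntegral_algebraMap_iff (FaithfulSMul.algebraMap_injective k L), ha]
    exact b.isIntegral_coe
  exact ⟨⟨a, hint⟩, RingOfIntegers.ext ha⟩


theorem mul_neg_sub_eq_of_trinomial_root {L : Type*} [Field L] [CharZero L] {p r W r₂ : L}
    (hr : r ^ 3 + p * r + 8 = 0) (hW : W ^ 2 = -(p ^ 3 + 432)) (hW0 : W ≠ 0)
    (hr₂ : 2 * W * r₂ = -W * r + (-3 * p * r ^ 2 + 36 * r - 2 * p ^ 2)) :
    r₂ * (-r - r₂) = p + r ^ 2 := by
  apply mul_left_cancel₀ (pow_ne_zero 2 (mul_ne_zero two_ne_zero hW0))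
  linear_combination (-(3 * r ^ 2 + 4 * p)) * hW - (9 * p ^ 2 * r - 216 * p) * hr -
    (2 * W * r₂ + W * r + (-3 * p * r ^ 2 + 36 * r - 2 * p ^ 2)) * hr₂

theorem eq_neg_sub_of_trinomial_root {L : Type*} [Field L] [CharZero L] {p r W r₂ r₃ : L}
    (hr : r ^ 3 + p * r + 8 = 0) (hW : W ^ 2 = -(p ^ 3 + 432)) (hW0 : W ≠ 0)
    (hr₂ : 2 * W * r₂ = -W * r + (-3 * p * r ^ 2 + 36 * r - 2 * p ^ 2))
    (hr₃ : 2 * W * r₃ = -W * r₂ + (-3 * p * r₂ ^ 2 + 36 * r₂ - 2 * p ^ 2)) :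
    r₃ = -r - r₂ := by
  have hprod := mul_neg_sub_eq_of_trinomial_root hr hW hW0 hr₂
  apply mul_left_cancel₀ (pow_ne_zero 2 (mul_ne_zero two_ne_zero hW0))
  linear_combination 2 * W * hr₃ + 6 * W * p * hprod + (3 * p * r + 36 + W) * hr₂ +
    3 * r * hW - 9 * p ^ 2 * hr

open Polynomial in
/-- The cyclic cubic extension generated by a root of `X ^ 3 + p X + 8` over a field containing a
square root of `-(p ^ 3 + 432)`. -/
theorem exists_cyclic_cubic_extension.{u} {k : Type u} [Field k] [NumberField k] {p : k}
    (hirr : Irreducible (X ^ 3 + C p * X + C 8 : k[X])) {w : k} (hw0 : w ≠ 0)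
    (hw : w ^ 2 = -(p ^ 3 + 432)) :
    ∃ (L : Type u) (_ : Field L) (_ : NumberField L) (_ : Algebra k L) (σ : L →ₐ[k] L) (r : L),
      Module.finrank k L = 3 ∧ (∀ x, σ (σ (σ x)) = x) ∧ r ^ 3 + algebraMap k L p * r + 8 = 0 ∧
      σ (σ r) = -r - σ r ∧ σ r * σ (σ r) = algebraMap k L p + r ^ 2 := by
  set f : k[X] := X ^ 3 + C p * X + C 8 with hf
  have hdeg : f.natDegree = 3 := by rw [hf]; compute_degree!
  have heval {S : Type u} [CommRing S] (i : k →+* S) (x : S) :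
      f.eval₂ i x = x ^ 3 + i p * x + i 8 := by
    rw [hf]
    simp only [eval₂_add, eval₂_mul, eval₂_pow, eval₂_X, eval₂_C]
  have hfact : Fact (Irreducible f) := ⟨hirr⟩
  have hkL : Module.finrank k (AdjoinRoot f) = 3 := by
    rw [(AdjoinRoot.powerBasis hirr.ne_zero).finrank, AdjoinRoot.powerBasis_dim, hdeg]
  have hfin : Module.Finite k (AdjoinRoot f) :=
    Module.finite_of_finrank_pos (by rw [hkL]; norm_num)
  have hL : NumberField (AdjoinRoot f) := NumberField.of_module_finite k _
  have hr : AdjoinRoot.root f ^ 3 + algebraMap k (AdjoinRoot f) p * AdjoinRoot.root f + 8 = 0 := by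
    have h := AdjoinRoot.eval₂_root f
    simpa only [heval, map_ofNat] using! h
  have hW2 : algebraMap k (AdjoinRoot f) w ^ 2 = -(algebraMap k (AdjoinRoot f) p ^ 3 + 432) := by
    rw [← map_pow, hw, map_neg, map_add, map_pow, map_ofNat]
  have hW0 : algebraMap k (AdjoinRoot f) w ≠ 0 :=
    (map_ne_zero_iff _ (FaithfulSMul.algebraMap_injective _ _)).mpr hw0
  obtain ⟨r₂, hr₂⟩ : ∃ r₂ : AdjoinRoot f, 2 * algebraMap k (AdjoinRoot f) w * r₂ =
      -algebraMap k (AdjoinRoot f) w * AdjoinRoot.root f +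
        (-3 * algebraMap k (AdjoinRoot f) p * AdjoinRoot.root f ^ 2 + 36 * AdjoinRoot.root f -
          2 * algebraMap k (AdjoinRoot f) p ^ 2) :=
    ⟨_, mul_div_cancel₀ _ (mul_ne_zero two_ne_zero hW0)⟩
  have hprod := mul_neg_sub_eq_of_trinomial_root hr hW2 hW0 hr₂
  have hroot : r₂ ^ 3 + algebraMap k (AdjoinRoot f) p * r₂ + 8 = 0 := by
    linear_combination (-r₂ + AdjoinRoot.root f) * hprod + hr
  let σ : AdjoinRoot f →ₐ[k] AdjoinRoot f := AdjoinRoot.liftAlgHom f (Algebra.ofId k _) r₂ (by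
    simpa only [heval, map_ofNat] using! hroot)
  have hσr : σ (AdjoinRoot.root f) = r₂ := AdjoinRoot.liftAlgHom_root _ _ _ _
  have hσr₂ : σ r₂ = -AdjoinRoot.root f - r₂ := by
    refine eq_neg_sub_of_trinomial_root hr hW2 hW0 hr₂ ?_
    simpa only [map_mul, map_add, map_sub, map_neg, map_pow, map_ofNat, hσr, σ.commutes]
      using congrArg σ hr₂
  have hσ3 : (σ.comp (σ.comp σ)) = AlgHom.id k _ := by
    apply AdjoinRoot.algHom_ext
    simp only [AlgHom.comp_apply, AlgHom.id_apply, hσr, hσr₂, map_sub, map_neg]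
    ring
  refine ⟨AdjoinRoot f, inferInstance, hL, inferInstance, σ, AdjoinRoot.root f, hkL,
    fun x ↦ DFunLike.congr_fun hσ3 x, hr, ?_, ?_⟩
  · rw [hσr, hσr₂]
  · rw [hσr, hσr₂, hprod]

open NumberField.RingOfIntegers in
open Polynomial in
theorem exists_not_isPrincipal_of_sq_eq {k : Type*} [Field k] [NumberField k]
    (h2 : Module.finrank ℚ k ≤ 2) {p : ℕ} (hp : p.Prime) (hp7 : 7 < p) {w : k}
    (hw : w ^ 2 = -((p ^ 3 + 432 : ℕ) : k)) :
    ∃ I : Ideal (𝓞 k), ¬ I.IsPrincipal ∧ (I ^ 3).IsPrincipal := by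
  have h3p : ¬ 3 ∣ p := fun h ↦ by
    have := (Nat.prime_dvd_prime_iff_eq Nat.prime_three hp).mp h
    omega
  have h3d : ¬ 3 ∣ p ^ 3 + 432 := fun h ↦
    h3p (Nat.prime_three.dvd_of_dvd_pow ((Nat.dvd_add_left (by norm_num : 3 ∣ 432)).mp h))
  have hw' : w ^ 2 = ((-((p ^ 3 + 432 : ℕ) : ℤ) : ℤ) : k) := by rw [hw]; push_cast; rfl
  have hneg : -((p ^ 3 + 432 : ℕ) : ℤ) < 0 := by
    rw [neg_lt_zero]
    positivity
  have htc : IsTotallyComplex k := isTotallyComplex_of_sq_eq hneg hw'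
  have hw0 : w ≠ 0 := by
    rintro rfl
    rw [zero_pow two_ne_zero, zero_eq_neg, Nat.cast_eq_zero] at hw
    omega
  obtain ⟨n, hn, hk⟩ := NumberField.Units.exists_pow_eq_one_of_finrank_le_two k h2
    (sq_ne_neg_three_of_finrank_le_two h2 (by positivity) h3d hw)
  obtain ⟨L, _, _, _, σ, r, hkL, hσ3, hr, hσσ, hprod⟩ := exists_cyclic_cubic_extension
    (irreducible_cubic_of_finrank_le_two h2 hp7) hw0 (by rw [hw]; push_cast; rfl)
  rw [map_natCast] at hr hprod
  have hcL : IsTotallyComplex L := isTotallyComplex_of_algebra k L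
  have hL : 0 < NumberField.Units.rank L := by
    have h := IsTotallyComplex.finrank L
    have hc := InfinitePlace.card_eq_nrRealPlaces_add_nrComplexPlaces L
    rw [IsTotallyComplex.nrRealPlaces_eq_zero] at hc
    have htow := Module.finrank_mul_finrank ℚ k L
    rw [hkL] at htow
    have hpos : 0 < Module.finrank ℚ k := Module.finrank_pos
    rw [NumberField.Units.rank, hc]
    omega
  have hint : IsIntegral ℤ r := by
    refine ⟨X ^ 3 + C (p : ℤ) * X + C 8, by monicity!, by simpa using hr⟩
  let s := mapAlgHom (k := k) σ
  have hs : ∀ b, s (s (s b)) = b := fun b ↦ RingOfIntegers.ext (hσ3 b)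
  let R : 𝓞 L := ⟨r, hint⟩
  have hR : R ^ 3 + p * R + 8 = 0 := RingOfIntegers.ext (by simpa using! hr)
  have hsum : s (s R) = -R - s R := RingOfIntegers.ext hσσ
  have hprod' : s R * s (s R) = p + R ^ 2 := RingOfIntegers.ext (by simpa using! hprod)
  generalize hR₂ : s R = R₂ at hsum hprod'
  rw [hsum] at hprod'
  have hcop : IsCoprime (3 * p : ℤ) (4 * (p ^ 3 + 432) : ℤ) := by
    have h : Nat.Coprime (3 * p) (4 * (p ^ 3 + 432)) := by
      apply Nat.Coprime.mul_left
      · rw [Nat.prime_three.coprime_iff_not_dvd, Nat.prime_three.dvd_mul]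
        omega
      · rw [hp.coprime_iff_not_dvd]
        intro h
        have h12 : p ∣ 12 ^ 3 := by
          have h' : p ∣ 4 * p ^ 3 + 12 ^ 3 := by convert h using 1; ring
          exact (Nat.dvd_add_right ((dvd_pow_self p three_ne_zero).mul_left 4)).mp h'
        have h12' := hp.dvd_of_dvd_pow h12
        have := Nat.le_of_dvd (by norm_num) h12'
        interval_cases p <;> revert hp h12' <;> norm_num
    exact_mod_cast Nat.isCoprime_iff_coprime.mpr h
  obtain ⟨a, b, hab⟩ := hcop
  have hab' : (a : 𝓞 L) * (3 * p) + b * (4 * (p ^ 3 + 432)) = 1 := by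
    exact_mod_cast congrArg (Int.cast : ℤ → 𝓞 L) hab
  have hd : (R - R₂) * (R - (-R - R₂)) = 3 * R ^ 2 + p := by
    linear_combination hprod'
  have hdd : (R₂ - (-R - R₂)) ^ 2 = -3 * R ^ 2 - 4 * p := by
    linear_combination -4 * hprod'
  have hdisc : (3 * R ^ 2 + p) ^ 2 * (-3 * R ^ 2 - 4 * p) = -(4 * (p ^ 3 + 432)) := by
    linear_combination -27 * (R ^ 3 + p * R - 8) * hR
  have hd0 : (R - R₂) * (R - (-R - R₂)) ≠ 0 := by
    intro h
    rw [← hd, h, zero_pow two_ne_zero, zero_mul] at hdisc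
    have : ((4 * (p ^ 3 + 432) : ℕ) : 𝓞 L) = 0 := by push_cast; linear_combination hdisc
    rw [Nat.cast_eq_zero] at this
    omega
  have hσr : σ r ≠ r := by
    intro h
    have h' : R₂ = R := hR₂ ▸ RingOfIntegers.ext h
    exact hd0 (by rw [h', sub_self, zero_mul])
  have hfix (b : 𝓞 L) (hb : s b = b) : ∃ a, algebraMap (𝓞 k) (𝓞 L) a = b :=
    mem_range_algebraMap_of_fixed (hkL ▸ Nat.prime_three) σ r hσr b
      (congrArg (fun x : 𝓞 L ↦ (x : L)) hb)
  refine exists_not_isPrincipal_of_cubic k L hkL hL n hn hk s hs hfix R ?_ ?_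
  · rwa [hR₂, hsum]
  · rw [hR₂, hsum]
    have hdiscr : (R - R₂) * (R - (-R - R₂)) * (((R₂ - (-R - R₂)) * (R₂ - R)) *
        (((-R - R₂) - R) * ((-R - R₂) - R₂))) = 4 * (p ^ 3 + 432) := by
      calc _ = -(((R - R₂) * (R - (-R - R₂))) ^ 2 * (R₂ - (-R - R₂)) ^ 2) := by ring
        _ = _ := by rw [hd, hdd, hdisc, neg_neg]
    refine ⟨-a + b * (((R₂ - (-R - R₂)) * (R₂ - R)) * (((-R - R₂) - R) * ((-R - R₂) - R₂))),
      -a, -a, ?_⟩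
    linear_combination hab' + b * hdiscr + 3 * a * hprod'

open IntermediateField Polynomial in
/-- For every prime `p > 7` the class group of `ℚ(√-3, √(-p³ - 432))` has an element of
order `3`. -/
theorem exists_orderOf_eq_three_adjoin {p : ℕ} (hp : p.Prime) (hp7 : 7 < p) {z w : ℂ}
    (hz : z ^ 2 = (-3 : ℂ)) (hw : w ^ 2 = ((-(p : ℤ) ^ 3 - 432 : ℤ) : ℂ)) :
    ∃ c : ClassGroup (𝓞 (adjoin ℚ ({z, w} : Set ℂ))), orderOf c = 3 := by
  have hquad (x : ℂ) (m : ℤ) (hx : x ^ 2 = m) : IsIntegral ℚ x ∧ Module.finrank ℚ ℚ⟮x⟯ ≤ 2 := by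
    have hmonic : (X ^ 2 - C (m : ℚ)).Monic := by monicity!
    have hroot : aeval x (X ^ 2 - C (m : ℚ)) = 0 := by simp [hx]
    have hxi : IsIntegral ℚ x := ⟨_, hmonic, hroot⟩
    refine ⟨hxi, ?_⟩
    rw [adjoin.finrank hxi]
    exact (natDegree_le_of_dvd (minpoly.dvd ℚ x hroot) hmonic.ne_zero).trans
      (by compute_degree!)
  obtain ⟨hzi, hzf⟩ := hquad z (-3) (by simpa using hz)
  obtain ⟨hwi, hwf⟩ := hquad w _ hw
  have hsup : adjoin ℚ ({z, w} : Set ℂ) = ℚ⟮z⟯ ⊔ ℚ⟮w⟯ := by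
    rw [← adjoin_union, Set.singleton_union]
  have := adjoin.finiteDimensional hzi
  have := adjoin.finiteDimensional hwi
  have hKfin : FiniteDimensional ℚ (adjoin ℚ ({z, w} : Set ℂ)) := by
    rw [hsup]
    infer_instance
  have hK4 : Module.finrank ℚ (adjoin ℚ ({z, w} : Set ℂ)) ≤ 4 := by
    rw [hsup]
    exact (finrank_sup_le _ _).trans (Nat.mul_le_mul hzf hwf)
  have hle : ℚ⟮w⟯ ≤ adjoin ℚ ({z, w} : Set ℂ) := adjoin.mono _ _ _ (by simp)
  have hnk : NumberField ℚ⟮w⟯ := ⟨⟩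
  have hnK : NumberField (adjoin ℚ ({z, w} : Set ℂ)) := ⟨⟩
  let : Algebra ℚ⟮w⟯ (adjoin ℚ ({z, w} : Set ℂ)) := (inclusion hle).toAlgebra
  have hgen : (AdjoinSimple.gen ℚ w) ^ 2 = -((p ^ 3 + 432 : ℕ) : ℚ⟮w⟯) := by
    apply (algebraMap ℚ⟮w⟯ ℂ).injective
    rw [map_pow, map_neg, map_natCast, AdjoinSimple.algebraMap_gen, hw]
    push_cast
    ring
  have hcop : (Module.finrank ℚ⟮w⟯ (adjoin ℚ ({z, w} : Set ℂ))).Coprime 3 := by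
    have hC : IsTotallyComplex ℚ⟮w⟯ := isTotallyComplex_of_sq_eq (m := -((p ^ 3 + 432 : ℕ) : ℤ))
      (w := AdjoinSimple.gen ℚ w) (by omega) (by rw [hgen, Int.cast_neg, Int.cast_natCast])
    have := hC.finrank
    have hpos := Module.finrank_pos (R := ℚ) (M := ℚ⟮w⟯)
    have htower : IsScalarTower ℚ ℚ⟮w⟯ (adjoin ℚ ({z, w} : Set ℂ)) :=
      .of_algebraMap_eq fun _ ↦ rfl
    have hmul := Module.finrank_mul_finrank ℚ ℚ⟮w⟯ (adjoin ℚ ({z, w} : Set ℂ))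
    have hKpos := Module.finrank_pos (R := ℚ) (M := adjoin ℚ ({z, w} : Set ℂ))
    have h2 : Module.finrank ℚ ℚ⟮w⟯ = 2 := by omega
    rw [h2] at hmul
    obtain h | h : Module.finrank ℚ⟮w⟯ (adjoin ℚ ({z, w} : Set ℂ)) = 1 ∨
        Module.finrank ℚ⟮w⟯ (adjoin ℚ ({z, w} : Set ℂ)) = 2 := by omega
    all_goals rw [h]; norm_num
  exact NumberField.exists_orderOf_eq_three ℚ⟮w⟯ (adjoin ℚ ({z, w} : Set ℂ)) hcop
    (exists_not_isPrincipal_of_sq_eq hwf hp hp7 hgen)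

/-- There are infinitely many primes `p` such that `−p³ − 432` is not a perfect square and the
class group of the imaginary biquadratic field `ℚ(√−3, √(−p³ − 432))` contains a nontrivial
element of order `3` or `6`. -/
theorem stmt_7 :
    {p : ℕ | p.Prime ∧ (¬ ∃ y : ℤ, y ^ 2 = -(p : ℤ) ^ 3 - 432) ∧
      ∀ z w : ℂ, z ^ 2 = (-3 : ℂ) → w ^ 2 = ((-(p : ℤ) ^ 3 - 432 : ℤ) : ℂ) →
        ∃ c : ClassGroup (𝓞 (IntermediateField.adjoin ℚ ({z, w} : Set ℂ))),
          c ≠ 1 ∧ (orderOf c = 3 ∨ orderOf c = 6)}.Infinite := by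
  refine (Nat.infinite_setOfPred_prime.sdiff (Set.finite_Iic 7)).mono ?_
  rintro p ⟨hp, hp7⟩
  refine ⟨hp, fun ⟨y, hy⟩ ↦ ?_, fun z w hz hw ↦ ?_⟩
  · have : (0 : ℤ) ≤ (p : ℤ) ^ 3 := by positivity
    nlinarith [sq_nonneg y]
  · obtain ⟨c, hc⟩ := exists_orderOf_eq_three_adjoin hp (by simpa using hp7) hz hw
    refine ⟨c, ?_, Or.inl hc⟩
    rintro rfl
    simp at hc
end
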